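/- Let n ∈ ℤ, n ≥ 2, let T_n be the times-n map on the circle 𝕋, let S ⊆ 𝕋 be a finite set, let t₀ > 0 and g = diag(e^{t₀}, e^{−t₀}) ∈ SL₂(ℝ). Then the set {s ∈ ℝ : the closure of 𝒪^ℕ_{T_n}([s]) in 𝕋 is disjoint from S, and the closure of {gᵏ·h₂(s) : k ∈ ℕ} equals X₂} has Hausdorff dimension 1. -/

import Mathlib

open MeasureTheory Matrix Filter Set
open scoped ENNReal

noncomputable section

/-- Topology on special linear groups (induced from the matrix topology). -/
instance (n : Type*) [DecidableEq n] [Fintype n] (R : Type*) [CommRing R] [TopologicalSpace R] :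
    TopologicalSpace (Matrix.SpecialLinearGroup n R) :=
  TopologicalSpace.induced (fun A => (A : Matrix n n R)) inferInstance

abbrev SL2R := Matrix.SpecialLinearGroup (Fin 2) ℝ
abbrev SL2Z := Matrix.SpecialLinearGroup (Fin 2) ℤ

/-- The image of `SL₂(ℤ)` in `SL₂(ℝ)`. -/
def SL2Zsub : Subgroup SL2R :=
  MonoidHom.range (Matrix.SpecialLinearGroup.map (n := Fin 2) (Int.castRingHom ℝ))

/-- The space of unimodular lattices `X₂ = SL₂(ℝ)/SL₂(ℤ)`. -/
abbrev X2 := SL2R ⧸ SL2Zsub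

/-- `h₂(s)` is the class of the matrix `[[1, s], [0, 1]]` in `X₂`. -/
def h2 (s : ℝ) : X2 :=
  QuotientGroup.mk ⟨!![(1:ℝ), s; 0, 1], by simp [Matrix.det_fin_two_of]⟩

/-- The diagonal matrix `diag(e^t, e^{-t}) ∈ SL₂(ℝ)`. -/
def g2 (t : ℝ) : SL2R :=
  ⟨!![Real.exp t, 0; 0, Real.exp (-t)], by
    simp [Matrix.det_fin_two_of, ← Real.exp_add]⟩

/-- The circle `𝕋 = ℝ/ℤ`. -/
abbrev Circ := UnitAddCircle

/-- The `1`-periodic tent of height and half-width `ω`, centred at the integers. -/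
def tent (ω x : ℝ) : ℝ := max 0 (ω - |x - round x|)

lemma tent_nonneg (ω x : ℝ) : 0 ≤ tent ω x := le_max_left _ _

lemma tent_le {ω : ℝ} (hω : 0 ≤ ω) (x : ℝ) : tent ω x ≤ ω :=
  max_le hω (sub_le_self _ (abs_nonneg _))

lemma exists_int_abs_sub_lt_of_tent_pos {ω x : ℝ} (h : 0 < tent ω x) :
    ∃ z : ℤ, |x - z| < ω := by
  refine ⟨round x, ?_⟩
  rcases lt_max_iff.1 h with h | h
  · exact absurd h (lt_irrefl _)
  · linarith

/-- The cosine coefficients of `tent ω`. -/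
def tentCoeff (ω : ℝ) (n : ℕ) : ℝ := (1 - Real.cos (2 * Real.pi * n * ω)) / (Real.pi ^ 2 * n ^ 2)

lemma tentCoeff_nonneg (ω : ℝ) (n : ℕ) : 0 ≤ tentCoeff ω n :=
  div_nonneg (sub_nonneg.2 (Real.cos_le_one _)) (by positivity)

lemma tentCoeff_le_sq (ω : ℝ) (n : ℕ) : tentCoeff ω n ≤ 2 * ω ^ 2 := by
  rcases Nat.eq_zero_or_pos n with rfl | hn
  · simp [tentCoeff]; positivity
  · have hn' : (0 : ℝ) < n := by exact_mod_cast hn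
    rw [tentCoeff, div_le_iff₀ (by positivity)]
    nlinarith [Real.one_sub_sq_div_two_le_cos (x := 2 * Real.pi * n * ω)]

lemma tentCoeff_le_inv_sq (ω : ℝ) {n : ℕ} (hn : 0 < n) : tentCoeff ω n ≤ 2 / (n : ℝ) ^ 2 := by
  have hn' : (0 : ℝ) < n := by exact_mod_cast hn
  rw [tentCoeff, div_le_div_iff₀ (by positivity) (by positivity)]
  have h1 := Real.neg_one_le_cos (2 * Real.pi * n * ω)
  have h2 : (1 : ℝ) ≤ Real.pi ^ 2 := by nlinarith [Real.pi_gt_three]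
  have h3 : (n : ℝ) ^ 2 ≤ Real.pi ^ 2 * n ^ 2 := by nlinarith [sq_nonneg (n : ℝ)]
  nlinarith [sq_nonneg (n : ℝ)]

lemma hasSum_cos_div_sq {x : ℝ} (hx : x ∈ Set.Icc (0 : ℝ) 1) :
    HasSum (fun n : ℕ => 1 / (n : ℝ) ^ 2 * Real.cos (2 * Real.pi * n * x))
      (Real.pi ^ 2 * (x ^ 2 - x + 1 / 6)) := by
  have h := hasSum_one_div_nat_pow_mul_cos one_ne_zero hx
  rw [Polynomial.eval_map_algebraMap] at h
  have hB : Polynomial.bernoulli 2 =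
      Polynomial.X ^ 2 - Polynomial.X + Polynomial.C (1 / 6 : ℚ) := by
    rw [Polynomial.bernoulli_def]
    simp only [Finset.sum_range_succ, Finset.sum_range_zero, ← Polynomial.C_mul_X_pow_eq_monomial]
    norm_num [bernoulli_two, bernoulli_one]
    ring
  simp only [mul_one] at h
  rw [hB] at h
  convert! h using 1
  simp only [map_add, map_sub, map_pow, Polynomial.aeval_X, Polynomial.aeval_C]
  rw [show (2 : ℕ).factorial = 2 from rfl, show (algebraMap ℚ ℝ) (1 / 6) = 1 / 6 by norm_num]
  push_cast
  ring

lemma hasSum_tent {ω : ℝ} (h0 : 0 < ω) (h1 : ω ≤ 1 / 2) (x : ℝ) :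
    HasSum (fun n : ℕ => tentCoeff ω n * Real.cos (2 * Real.pi * n * x)) (tent ω x - ω ^ 2) := by
  set y := |x - round x| with hy
  have hy0 : 0 ≤ y := abs_nonneg _
  have hy1 : y ≤ 1 / 2 := abs_sub_round x
  have hcos : ∀ n : ℕ, Real.cos (2 * Real.pi * n * x) = Real.cos (2 * Real.pi * n * y) := by
    intro n
    rw [hy, ← Real.cos_abs (2 * Real.pi * n * |x - round x|), abs_mul, abs_abs, ← abs_mul,
      Real.cos_abs, ← Real.cos_sub_int_mul_two_pi (2 * Real.pi * n * x) (n * round x)]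
    congr 1; push_cast; ring
  have hy' : |y - ω| ∈ Set.Icc (0 : ℝ) 1 :=
    ⟨abs_nonneg _, abs_le.2 ⟨by linarith, by linarith⟩⟩
  have s1 := hasSum_cos_div_sq (x := y) ⟨hy0, by linarith⟩
  have s2 := hasSum_cos_div_sq (x := y + ω) ⟨by linarith, by linarith⟩
  have s3 := hasSum_cos_div_sq hy'
  have s := (s1.sub ((s2.add s3).mul_left (1 / 2))).mul_left (1 / Real.pi ^ 2)
  convert! s using 1
  · ext n
    rw [hcos, tentCoeff]
    have e3 : Real.cos (2 * Real.pi * n * |y - ω|) = Real.cos (2 * Real.pi * n * (y - ω)) := by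
      rw [← Real.cos_abs (2 * Real.pi * n * |y - ω|), abs_mul, abs_abs, ← abs_mul, Real.cos_abs]
    rw [e3, mul_add (2 * Real.pi * n) y ω, mul_sub (2 * Real.pi * n) y ω, Real.cos_add,
        Real.cos_sub]
    rcases Nat.eq_zero_or_pos n with rfl | hn
    · simp
    · have hn' : (n : ℝ) ≠ 0 := by positivity
      have := Real.pi_ne_zero
      field_simp
      ring
  · have := Real.pi_ne_zero
    have hsq := sq_abs (y - ω)
    rw [tent, ← hy, hsq]
    rcases le_total y ω with h | h
    · rw [max_eq_right (by linarith), abs_of_nonpos (by linarith)]; field_simp; ring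
    · rw [max_eq_left (by linarith), abs_of_nonneg (by linarith)]; field_simp; ring

/-- The sum of the translates of `tent ω` by the multiples of `1 / e`. -/
def tentSum (ω : ℝ) (e : ℕ) (x : ℝ) : ℝ := ∑ p ∈ Finset.range e, tent ω (x - p / e)

lemma sum_cos_sub_div (e n : ℕ) (he : 0 < e) (x : ℝ) :
    ∑ p ∈ Finset.range e, Real.cos (2 * Real.pi * n * (x - p / e)) =
      if e ∣ n then e * Real.cos (2 * Real.pi * n * x) else 0 := by
  have he' : (e : ℝ) ≠ 0 := by positivity
  split_ifs with h
  · obtain ⟨k, rfl⟩ := h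
    rw [Finset.sum_congr rfl (g := fun _ => Real.cos (2 * Real.pi * (e * k : ℕ) * x))]
    · simp
    · intro p _
      rw [← Real.cos_sub_nat_mul_two_pi (2 * Real.pi * (e * k : ℕ) * x) (k * p)]
      congr 1; push_cast; field_simp
  · have hz : ∑ p ∈ Finset.range e,
        Complex.exp (2 * Real.pi * n * (x - p / e) * Complex.I) = 0 := by
      have hprim := Complex.isPrimitiveRoot_exp e he.ne'
      set ζ := Complex.exp (2 * Real.pi * Complex.I / e) with hζ
      have h1 : (ζ⁻¹) ^ n ≠ 1 := by
        rw [inv_pow, Ne, inv_eq_one, hprim.pow_eq_one_iff_dvd]; exact h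
      have h2 : ∑ p ∈ Finset.range e, ((ζ⁻¹) ^ n) ^ p = 0 := by
        have hone : ((ζ⁻¹) ^ n) ^ e = 1 := by
          rw [← pow_mul, mul_comm n e, pow_mul, inv_pow, hprim.pow_eq_one, inv_one, one_pow]
        have := geom_sum_mul ((ζ⁻¹) ^ n) e
        rw [hone, sub_self] at this
        exact (mul_eq_zero.1 this).resolve_right (sub_ne_zero.2 h1)
      have h3 : ∀ p : ℕ, Complex.exp (2 * Real.pi * n * (x - p / e) * Complex.I) =
          Complex.exp (2 * Real.pi * n * x * Complex.I) * ((ζ⁻¹) ^ n) ^ p := by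
        intro p
        rw [hζ, ← Complex.exp_neg, ← Complex.exp_nat_mul, ← Complex.exp_nat_mul, ← Complex.exp_add]
        congr 1
        field_simp
        ring
      rw [Finset.sum_congr rfl fun p _ => h3 p, ← Finset.mul_sum, h2, mul_zero]
    have hre := congrArg Complex.re hz
    rw [Complex.re_sum] at hre
    rw [← Complex.zero_re, ← hre]
    refine Finset.sum_congr rfl fun p _ => ?_
    rw [← Complex.exp_ofReal_mul_I_re]
    push_cast; rfl

lemma hasSum_tentSum {ω : ℝ} (h0 : 0 < ω) (h1 : ω ≤ 1 / 2) {e : ℕ} (he : 0 < e) (x : ℝ) :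
    HasSum (fun n : ℕ => tentCoeff ω n * (if e ∣ n then (e : ℝ) else 0) *
      Real.cos (2 * Real.pi * n * x)) (tentSum ω e x - e * ω ^ 2) := by
  have h := hasSum_sum (s := Finset.range e) fun p _ => hasSum_tent h0 h1 (x - (p : ℝ) / e)
  rw [Finset.sum_sub_distrib, Finset.sum_const, Finset.card_range, nsmul_eq_mul] at h
  convert! h using 1
  ext n
  rw [← Finset.mul_sum, sum_cos_sub_div e n he]
  split_ifs <;> ring

lemma succ_pow_three_le_eight_pow (k : ℕ) : (k + 1) ^ 3 ≤ 8 ^ k := by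
  induction k with
  | zero => norm_num
  | succ k ih => rw [pow_succ 8]; nlinarith [Nat.zero_le k, Nat.zero_le (k ^ 2),
      Nat.zero_le (k ^ 3)]

lemma succ_pow_three_le_eight_mul_two_pow (k : ℕ) : (k + 1) ^ 3 ≤ 8 * 2 ^ k := by
  rcases Nat.lt_or_ge k 5 with h | h
  · interval_cases k <;> norm_num
  · induction k, h using Nat.le_induction with
    | base => norm_num
    | succ k hk ih =>
      rw [pow_succ 2]
      have : (k + 1 + 1) ^ 3 ≤ 2 * (k + 1) ^ 3 := by
        obtain ⟨j, rfl⟩ := Nat.exists_eq_add_of_le hk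
        ring_nf
        nlinarith [Nat.zero_le j, Nat.zero_le (j ^ 2), Nat.zero_le (j ^ 3)]
      omega

/-- The divisor bound `d(n) = O(n ^ (1 / 3))`. -/
lemma card_divisors_pow_three_le (n : ℕ) : n.divisors.card ^ 3 ≤ 4096 * n := by
  rcases Nat.eq_zero_or_pos n with rfl | hn
  · simp
  have key : ∀ n : ℕ, 0 < n →
      n.divisors.card ^ 3 ≤ 8 ^ (n.primeFactors ∩ Finset.range 8).card * n := by
    intro n
    induction n using Nat.recOnPosPrimePosCoprime with
    | zero => intro h; exact absurd h (lt_irrefl _)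
    | one => simp
    | prime_pow p k hp hk =>
      intro _
      rw [Nat.divisors_prime_pow hp, Finset.card_map, Finset.card_range,
        Nat.primeFactors_prime_pow hk.ne' hp]
      rcases lt_or_ge p 8 with h8 | h8
      · rw [Finset.inter_eq_left.2 (by simpa using h8), Finset.card_singleton, pow_one]
        exact (succ_pow_three_le_eight_mul_two_pow k).trans
          (Nat.mul_le_mul_left _ (Nat.pow_le_pow_left hp.two_le k))
      · calc (k + 1) ^ 3 ≤ 8 ^ k := succ_pow_three_le_eight_pow k
          _ ≤ p ^ k := Nat.pow_le_pow_left h8 k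
          _ ≤ _ := Nat.le_mul_of_pos_left _ (by positivity)
    | coprime a b ha hb hab iha ihb =>
      intro _
      rw [hab.card_divisors_mul, hab.primeFactors_mul, Finset.union_inter_distrib_right,
        Finset.card_union_of_disjoint (Disjoint.mono Finset.inter_subset_left
          Finset.inter_subset_left hab.disjoint_primeFactors), mul_pow, pow_add]
      calc _ ≤ _ := Nat.mul_le_mul (iha (by omega)) (ihb (by omega))
        _ = _ := by ring
  refine (key n hn).trans (Nat.mul_le_mul_right _ ?_)
  rw [show 4096 = 8 ^ 4 by norm_num]
  refine Nat.pow_le_pow_right (by norm_num) ?_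
  have : n.primeFactors ∩ Finset.range 8 ⊆ {2, 3, 5, 7} := by
    intro p hp
    rw [Finset.mem_inter, Finset.mem_range] at hp
    have h1 := Nat.prime_of_mem_primeFactors hp.1
    have h2 := hp.2
    interval_cases p <;> first | decide | exact absurd h1 (by norm_num)
  exact (Finset.card_le_card this).trans (by simp)

lemma card_divisors_le_rpow (n : ℕ) : (n.divisors.card : ℝ) ≤ 16 * (n : ℝ) ^ (1 / 3 : ℝ) := by
  have h : ((n.divisors.card : ℝ)) ^ 3 ≤ 4096 * n := by
    exact_mod_cast card_divisors_pow_three_le n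
  have h0 : (0 : ℝ) ≤ (n : ℝ) ^ (1 / 3 : ℝ) := by positivity
  refine le_of_pow_le_pow_left₀ (n := 3) (by norm_num) (by positivity) (h.trans (le_of_eq ?_))
  rw [mul_pow, ← Real.rpow_natCast, ← Real.rpow_natCast, ← Real.rpow_mul (by positivity)]
  norm_num

/-- `s` is within `ω` of `x₀ + p / q` for a reduced fraction with `a < q ≤ b`. -/
def ReducedApprox (a b : ℕ) (x₀ ω s : ℝ) : Prop :=
  ∃ q ∈ Finset.Ioc a b, ∃ p : ℤ, IsCoprime p (q : ℤ) ∧ |s - x₀ - p / q| < ω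

lemma tentSum_sub_properDivisors_le (ω : ℝ) {q : ℕ} (hq : 0 < q) (x : ℝ) :
    tentSum ω q x - ∑ e ∈ q.properDivisors, tentSum ω e x ≤
      ∑ p ∈ (Finset.range q).filter (fun p => p.Coprime q), tent ω (x - p / q) := by
  have h1 : ∑ p ∈ (Finset.range q).filter (fun p => ¬ p.Coprime q), tent ω (x - p / q) ≤
      ∑ e ∈ q.properDivisors, tentSum ω e x := by
    simp only [tentSum]
    rw [Finset.sum_sigma']
    set i : ℕ → (_ : ℕ) × ℕ := fun p => ⟨q / p.gcd q, p / p.gcd q⟩ with hi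
    have hg : ∀ p : ℕ, 0 < p.gcd q := fun p => Nat.gcd_pos_of_pos_right _ hq
    have hinj : Set.InjOn i ((Finset.range q).filter (fun p => ¬ p.Coprime q) : Finset ℕ) := by
      intro p _ p' _ h
      rw [hi] at h
      simp only [Sigma.mk.injEq, heq_eq_eq] at h
      have e1 := Nat.div_mul_cancel (Nat.gcd_dvd_right p q)
      have e2 := Nat.div_mul_cancel (Nat.gcd_dvd_right p' q)
      have e3 := Nat.div_mul_cancel (Nat.gcd_dvd_left p q)
      have e4 := Nat.div_mul_cancel (Nat.gcd_dvd_left p' q)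
      have hpos : 0 < q / p'.gcd q := Nat.div_pos (Nat.gcd_le_right _ hq) (hg p')
      rw [h.1, ← e2] at e1
      rw [e2] at e1
      have : p.gcd q = p'.gcd q := Nat.eq_of_mul_eq_mul_left hpos (e1.trans e2.symm)
      rw [← e3, ← e4, h.2, this]
    have : ∀ p ∈ (Finset.range q).filter (fun p => ¬ p.Coprime q),
        tent ω (x - p / q) = tent ω (x - (i p).2 / (i p).1) := by
      intro p _
      have hgp : ((p.gcd q : ℕ) : ℝ) ≠ 0 := by exact_mod_cast (hg p).ne'
      simp only [hi]
      rw [Nat.cast_div (Nat.gcd_dvd_left p q) hgp, Nat.cast_div (Nat.gcd_dvd_right p q) hgp,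
        div_div_div_cancel_right₀ hgp]
    rw [Finset.sum_congr rfl this, ← Finset.sum_image (f := fun y : (_ : ℕ) × ℕ =>
      tent ω (x - y.2 / y.1)) hinj]
    refine Finset.sum_le_sum_of_subset_of_nonneg ?_ fun _ _ _ => tent_nonneg _ _
    intro y hy
    obtain ⟨p, hp, rfl⟩ := Finset.mem_image.1 hy
    rw [Finset.mem_filter, Finset.mem_range, Nat.Coprime] at hp
    have h2 : 1 < p.gcd q := by have := hg p; omega
    simp only [hi, Finset.mem_sigma, Nat.mem_properDivisors, Finset.mem_range]
    exact ⟨⟨Nat.div_dvd_of_dvd (Nat.gcd_dvd_right p q), Nat.div_lt_self hq h2⟩,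
      Nat.div_lt_div_of_lt_of_dvd (Nat.gcd_dvd_right p q) hp.1⟩
  have h2 := Finset.sum_filter_add_sum_filter_not (Finset.range q) (fun p => p.Coprime q)
    (fun p => tent ω (x - p / q))
  rw [tentSum]
  linarith

lemma eq_of_abs_div_sub_div_lt {b q q' : ℕ} (hq : 0 < q) (hq' : 0 < q') (hqb : q ≤ b)
    (hqb' : q' ≤ b) {P P' : ℤ} (hP : IsCoprime P q) (hP' : IsCoprime P' q')
    (h : |(P : ℝ) / q - P' / q'| < 1 / b ^ 2) : q = q' ∧ P = P' := by
  have hqr : (0 : ℝ) < q := by exact_mod_cast hq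
  have hqr' : (0 : ℝ) < q' := by exact_mod_cast hq'
  have hb : (0 : ℝ) < b := by exact_mod_cast hq.trans_le hqb
  have hqbr : (q : ℝ) ≤ b := by exact_mod_cast hqb
  have hqbr' : (q' : ℝ) ≤ b := by exact_mod_cast hqb'
  have h0 : P * q' - q * P' = 0 := by
    rw [← Int.abs_lt_one_iff, ← Int.cast_lt (R := ℝ)]
    rw [div_sub_div _ _ hqr.ne' hqr'.ne', abs_div, abs_of_pos (mul_pos hqr hqr'),
      div_lt_div_iff₀ (by positivity) (by positivity), one_mul] at h
    push_cast
    have : (q : ℝ) * q' ≤ b ^ 2 := by nlinarith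
    by_contra! hc
    nlinarith [sq_nonneg (b : ℝ)]
  have h1 : (q : ℤ) ∣ q' := hP.symm.dvd_of_dvd_mul_left ⟨P', by linarith⟩
  have h2 : (q' : ℤ) ∣ q := hP'.symm.dvd_of_dvd_mul_right ⟨P, by linarith⟩
  have h3 : q = q' := Nat.dvd_antisymm (Int.natCast_dvd_natCast.1 h1) (Int.natCast_dvd_natCast.1 h2)
  subst h3
  refine ⟨rfl, ?_⟩
  have hqz : (q : ℤ) ≠ 0 := by exact_mod_cast hq.ne'
  exact mul_right_cancel₀ hqz (by linarith)

lemma sum_tent_coprime_le {a b : ℕ} {ω : ℝ} (hω : 0 ≤ ω) (hb : 2 * ω ≤ 1 / (b : ℝ) ^ 2) (x : ℝ) :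
    ∑ q ∈ Finset.Ioc a b, ∑ p ∈ (Finset.range q).filter (fun p => p.Coprime q),
      tent ω (x - p / q) ≤ ω := by
  rw [Finset.sum_sigma']
  set I := (Finset.Ioc a b).sigma fun q => (Finset.range q).filter (fun p => p.Coprime q) with hI
  by_cases hne : ∃ y ∈ I, 0 < tent ω (x - y.2 / y.1)
  · obtain ⟨y, hy, hpos⟩ := hne
    rw [Finset.sum_eq_single_of_mem y hy]
    · exact tent_le hω _
    · intro y' hy' hney
      by_contra hc
      have hpos' := (tent_nonneg ω (x - y'.2 / y'.1)).lt_of_ne' hc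
      obtain ⟨z, hz⟩ := exists_int_abs_sub_lt_of_tent_pos hpos
      obtain ⟨z', hz'⟩ := exists_int_abs_sub_lt_of_tent_pos hpos'
      obtain ⟨q, p⟩ := y
      obtain ⟨q', p'⟩ := y'
      simp only [hI, Finset.mem_sigma, Finset.mem_Ioc, Finset.mem_filter, Finset.mem_range]
        at hy hy' hz hz'
      have hq : 0 < q := by omega
      have hq' : 0 < q' := by omega
      have hqr : (q : ℝ) ≠ 0 := by positivity
      have hqr' : (q' : ℝ) ≠ 0 := by positivity
      have hc1 : IsCoprime ((p : ℤ) + q * z) (q : ℤ) := by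
        rw [IsCoprime.add_mul_left_left_iff]
        exact Nat.isCoprime_iff_coprime.2 hy.2.2
      have hc2 : IsCoprime ((p' : ℤ) + q' * z') (q' : ℤ) := by
        rw [IsCoprime.add_mul_left_left_iff]
        exact Nat.isCoprime_iff_coprime.2 hy'.2.2
      have := eq_of_abs_div_sub_div_lt hq hq' hy.1.2 hy'.1.2 hc1 hc2 (by
        push_cast
        have e1 : ((p : ℝ) + q * z) / q - (p' + q' * z') / q' =
          (x - p' / q' - z') - (x - p / q - z) := by field_simp; ring
        rw [e1]
        calc _ ≤ |x - p' / q' - z'| + |x - p / q - z| := abs_sub _ _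
          _ < 2 * ω := by linarith
          _ ≤ _ := hb)
      obtain ⟨rfl, h2⟩ := this
      apply hney
      have : p = p' := by
        have hm : (p : ℤ) % q = p' % q := by
          have := congrArg (· % (q : ℤ)) h2
          simpa using this
        rw [Int.emod_eq_of_lt (by positivity) (by exact_mod_cast hy.2.1),
          Int.emod_eq_of_lt (by positivity) (by exact_mod_cast hy'.2.1)] at hm
        exact_mod_cast hm
      rw [this]
  · push Not at hne
    exact (Finset.sum_nonpos hne).trans hω

/-- The sieved sum of tents. -/
def sieveSum (a b : ℕ) (ω x : ℝ) : ℝ :=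
  ∑ q ∈ Finset.Ioc a b, (tentSum ω q x - ∑ e ∈ q.properDivisors, tentSum ω e x)

open Classical in
lemma sieveSum_le_indicator {a b : ℕ} {ω : ℝ} (hω : 0 ≤ ω) (hb : 2 * ω ≤ 1 / (b : ℝ) ^ 2)
    (x₀ s : ℝ) :
    sieveSum a b ω (s - x₀) ≤ Set.indicator {s | ReducedApprox a b x₀ ω s} (fun _ => ω) s := by
  have h1 : sieveSum a b ω (s - x₀) ≤ ∑ q ∈ Finset.Ioc a b,
      ∑ p ∈ (Finset.range q).filter (fun p => p.Coprime q), tent ω (s - x₀ - p / q) :=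
    Finset.sum_le_sum fun q hq => tentSum_sub_properDivisors_le ω
      (by rw [Finset.mem_Ioc] at hq; omega) _
  by_cases h : ReducedApprox a b x₀ ω s
  · rw [Set.indicator_of_mem (by exact h)]
    exact h1.trans (sum_tent_coprime_le hω hb _)
  · rw [Set.indicator_of_notMem (by exact h)]
    refine h1.trans (Finset.sum_nonpos fun q hq => Finset.sum_nonpos fun p hp => ?_)
    by_contra! hpos
    obtain ⟨z, hz⟩ := exists_int_abs_sub_lt_of_tent_pos hpos
    rw [Finset.mem_filter] at hp
    have hq0 : 0 < q := by rw [Finset.mem_Ioc] at hq; omega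
    refine h ⟨q, hq, p + q * z, ?_, ?_⟩
    · rw [IsCoprime.add_mul_left_left_iff]
      exact Nat.isCoprime_iff_coprime.2 hp.2
    · have hqr : (q : ℝ) ≠ 0 := by positivity
      convert! hz using 2
      push_cast; field_simp; ring

lemma sum_Icc_two_inv_sq_le (b : ℕ) : ∑ l ∈ Finset.Icc 2 b, 1 / (l : ℝ) ^ 2 ≤ 3 / 4 := by
  have key : ∀ n : ℕ, ∑ l ∈ Finset.Icc 2 (n + 2), 1 / (l : ℝ) ^ 2 ≤ 3 / 4 - 1 / ((n : ℝ) + 2) := by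
    intro n
    induction n with
    | zero => norm_num
    | succ n ih =>
      rw [show n + 1 + 2 = (n + 2) + 1 by ring, Finset.sum_Icc_succ_top (by omega)]
      have h : 1 / ((n + 2 + 1 : ℕ) : ℝ) ^ 2 ≤ 1 / ((n : ℝ) + 2) - 1 / (((n + 1 : ℕ) : ℝ) + 2) := by
        push_cast
        rw [div_sub_div _ _ (by positivity) (by positivity), div_le_div_iff₀ (by positivity)
          (by positivity)]
        nlinarith [Nat.cast_nonneg (α := ℝ) n]
      linarith
  rcases Nat.lt_or_ge b 2 with h | h
  · rw [Finset.Icc_eq_empty (by omega)]; norm_num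
  · obtain ⟨n, rfl⟩ := Nat.exists_eq_add_of_le' h
    have := key n
    have : (0 : ℝ) ≤ 1 / ((n : ℝ) + 2) := by positivity
    linarith

lemma sum_Icc_two_inv_le (b : ℕ) : ∑ l ∈ Finset.Icc 2 b, 1 / (l : ℝ) ≤ 1 + Real.log b := by
  refine le_trans ?_ (harmonic_le_one_add_log b)
  rw [harmonic_eq_sum_Icc]
  push_cast
  simp_rw [one_div]
  exact Finset.sum_le_sum_of_subset_of_nonneg (Finset.Icc_subset_Icc_left (by norm_num))
    fun _ _ _ => by positivity

lemma sum_properDivisors_le (a b : ℕ) (hab : a ≤ b) :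
    ∑ q ∈ Finset.Ioc a b, ∑ e ∈ q.properDivisors, (e : ℝ) ≤
      3 / 4 * (b * (b - a)) + b * (1 + Real.log b) := by
  have h1 : ∑ q ∈ Finset.Ioc a b, ∑ e ∈ q.properDivisors, (e : ℝ) ≤
      ∑ l ∈ Finset.Icc 2 b, ∑ e ∈ Finset.Ioc (a / l) (b / l), (e : ℝ) := by
    rw [Finset.sum_sigma', Finset.sum_sigma']
    set i : (_ : ℕ) × ℕ → (_ : ℕ) × ℕ := fun y => ⟨y.1 / y.2, y.2⟩ with hi
    have hdvd : ∀ y ∈ (Finset.Ioc a b).sigma fun q => q.properDivisors,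
        y.2 ∣ y.1 ∧ y.2 < y.1 ∧ a < y.1 ∧ y.1 ≤ b := by
      intro y hy
      rw [Finset.mem_sigma, Nat.mem_properDivisors, Finset.mem_Ioc] at hy
      exact ⟨hy.2.1, hy.2.2, hy.1⟩
    have hinj : Set.InjOn i ((Finset.Ioc a b).sigma fun q => q.properDivisors :
        Finset ((_ : ℕ) × ℕ)) := by
      rintro ⟨q, e⟩ hy ⟨q', e'⟩ hy' h
      simp only [hi, Sigma.mk.injEq, heq_eq_eq] at h
      obtain ⟨h1, rfl⟩ := h
      have e1 := Nat.div_mul_cancel (hdvd _ hy).1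
      have e2 := Nat.div_mul_cancel (hdvd _ hy').1
      simp only at e1 e2
      rw [h1, e2] at e1
      rw [e1]
    rw [← Finset.sum_image (f := fun y : (_ : ℕ) × ℕ => (y.2 : ℝ)) (g := i) hinj]
    refine Finset.sum_le_sum_of_subset_of_nonneg ?_ fun _ _ _ => by positivity
    intro y hy
    obtain ⟨⟨q, e⟩, hp, rfl⟩ := Finset.mem_image.1 hy
    obtain ⟨⟨l, hl⟩, h2, h3, h4⟩ := hdvd _ hp
    simp only at hl h2 h3 h4
    subst hl
    have he : 0 < e := Nat.pos_of_ne_zero (by rintro rfl; omega)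
    have hl0 : 1 < l := by by_contra! hc; nlinarith
    simp only [hi, Finset.mem_sigma, Finset.mem_Icc, Finset.mem_Ioc, Nat.mul_div_cancel_left _ he]
    exact ⟨⟨hl0, by nlinarith⟩, by rwa [Nat.div_lt_iff_lt_mul (by omega)],
      by rwa [Nat.le_div_iff_mul_le (by omega)]⟩
  have h2 : ∀ l ∈ Finset.Icc 2 b, ∑ e ∈ Finset.Ioc (a / l) (b / l), (e : ℝ) ≤
      b * (b - a) * (1 / (l : ℝ) ^ 2) + b * (1 / l) := by
    intro l hl
    rw [Finset.mem_Icc] at hl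
    have hl0 : (0 : ℝ) < l := by exact_mod_cast (by omega : 0 < l)
    have hb : ((b / l : ℕ) : ℝ) ≤ b / l := Nat.cast_div_le
    have ha : (a : ℝ) / l - 1 ≤ (a / l : ℕ) := by
      have := Nat.lt_floor_add_one ((a : ℝ) / l)
      rw [Nat.floor_div_natCast, Nat.floor_natCast] at this
      linarith
    have hle : a / l ≤ b / l := Nat.div_le_div_right hab
    calc ∑ e ∈ Finset.Ioc (a / l) (b / l), (e : ℝ)
        ≤ ∑ e ∈ Finset.Ioc (a / l) (b / l), (b / l : ℝ) := by
          refine Finset.sum_le_sum fun e he => ?_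
          rw [Finset.mem_Ioc] at he
          exact le_trans (by exact_mod_cast he.2) hb
      _ = ((b / l : ℕ) - (a / l : ℕ) : ℝ) * (b / l) := by
          rw [Finset.sum_const, Nat.card_Ioc, nsmul_eq_mul, Nat.cast_sub hle]
      _ ≤ (b / l - (a / l - 1)) * (b / l) := by
          refine mul_le_mul_of_nonneg_right (by linarith) (by positivity)
      _ = _ := by field_simp; ring
  calc _ ≤ _ := h1
    _ ≤ _ := Finset.sum_le_sum h2
    _ = b * (b - a) * ∑ l ∈ Finset.Icc 2 b, 1 / (l : ℝ) ^ 2 +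
        b * ∑ l ∈ Finset.Icc 2 b, 1 / (l : ℝ) := by
      rw [Finset.sum_add_distrib, Finset.mul_sum, Finset.mul_sum]
    _ ≤ b * (b - a) * (3 / 4) + b * (1 + Real.log b) := by
      have : (a : ℝ) ≤ b := by exact_mod_cast hab
      have : (0 : ℝ) ≤ b * (b - a) := mul_nonneg (by positivity) (by linarith)
      gcongr
      · exact sum_Icc_two_inv_sq_le b
      · exact sum_Icc_two_inv_le b
    _ = _ := by ring

lemma eventually_sum_sub_properDivisors {τ : ℝ} (hτ : 0 < τ) (hτ' : τ ≤ 1 / 20) :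
    ∀ᶠ Q : ℝ in atTop, τ / 20 * Q ^ 2 ≤
      ∑ q ∈ Finset.Ioc ⌊Q⌋₊ ⌊(1 + τ) * Q⌋₊, ((q : ℝ) - ∑ e ∈ q.properDivisors, (e : ℝ)) := by
  have hlog : ∀ᶠ Q : ℝ in atTop, 2 * (1 + Real.log (2 * Q)) ≤ τ / 20 * Q := by
    have h1 : Tendsto (fun Q : ℝ => Real.log (2 * Q) / (2 * Q)) atTop (nhds 0) :=
      Real.isLittleO_log_id_atTop.tendsto_div_nhds_zero.comp
        (tendsto_id.const_mul_atTop (by norm_num : (0 : ℝ) < 2))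
    have h2 := h1.eventually (gt_mem_nhds (show (0 : ℝ) < τ / 160 by positivity))
    filter_upwards [h2, eventually_ge_atTop (80 / τ), eventually_gt_atTop 0] with Q h3 h4 h5
    rw [div_lt_iff₀ (by positivity)] at h3
    rw [div_le_iff₀ hτ] at h4
    nlinarith
  filter_upwards [hlog, eventually_ge_atTop (100 : ℝ), eventually_ge_atTop (2 / τ)] with Q h1 h2 h3
  rw [div_le_iff₀ hτ] at h3
  set a := ⌊Q⌋₊ with ha
  set b := ⌊(1 + τ) * Q⌋₊ with hb
  have a1 : (a : ℝ) ≤ Q := Nat.floor_le (by linarith)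
  have a2 : Q - 1 < a := Nat.sub_one_lt_floor Q
  have b1 : (b : ℝ) ≤ (1 + τ) * Q := Nat.floor_le (by positivity)
  have b2 : (1 + τ) * Q - 1 < b := Nat.sub_one_lt_floor _
  have hab : a ≤ b := Nat.floor_le_floor (by nlinarith)
  have hab' : (a : ℝ) ≤ b := by exact_mod_cast hab
  have hb2 : (b : ℝ) ≤ 21 / 20 * Q := by nlinarith
  have hb0 : (0 : ℝ) < b := by linarith
  have s1 := sum_properDivisors_le a b hab
  have s2 : (a : ℝ) * (b - a) ≤ ∑ q ∈ Finset.Ioc a b, (q : ℝ) := by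
    calc (a : ℝ) * (b - a) = ∑ q ∈ Finset.Ioc a b, (a : ℝ) := by
          rw [Finset.sum_const, Nat.card_Ioc, nsmul_eq_mul, Nat.cast_sub hab]; ring
      _ ≤ _ := by
        refine Finset.sum_le_sum fun q hq => ?_
        rw [Finset.mem_Ioc] at hq
        exact_mod_cast hq.1.le
  have hl : Real.log b ≤ Real.log (2 * Q) := Real.log_le_log hb0 (by linarith)
  have hl1 : b * (1 + Real.log b) ≤ 2 * Q * (1 + Real.log (2 * Q)) := by
    have : 0 ≤ Real.log (2 * Q) := Real.log_nonneg (by linarith)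
    calc b * (1 + Real.log b) ≤ b * (1 + Real.log (2 * Q)) := by gcongr
      _ ≤ _ := by gcongr; linarith
  have hl2 : 2 * Q * (1 + Real.log (2 * Q)) ≤ τ / 20 * Q ^ 2 := by nlinarith
  rw [Finset.sum_sub_distrib]
  have hc : τ / 10 * Q ^ 2 ≤ (a - 3 / 4 * b) * (b - a) := by
    have e1 : Q / 5 ≤ a - 3 / 4 * (b : ℝ) := by linarith
    have e2 : τ * Q / 2 ≤ b - (a : ℝ) := by linarith
    calc τ / 10 * Q ^ 2 = (Q / 5) * (τ * Q / 2) := by ring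
      _ ≤ _ := mul_le_mul e1 e2 (by positivity) (by linarith)
  linarith

/-- The Fourier transform of a measure on the line. -/
def fourierMass (ρ : Measure ℝ) (t : ℝ) : ℂ :=
  ∫ s, Complex.exp (((2 * Real.pi * t * s : ℝ) : ℂ) * Complex.I) ∂ρ

lemma integrable_exp_mul_I (ρ : Measure ℝ) [IsFiniteMeasure ρ] (t : ℝ) :
    Integrable (fun s : ℝ => Complex.exp (((2 * Real.pi * t * s : ℝ) : ℂ) * Complex.I)) ρ := by
  refine Integrable.of_bound (by fun_prop) 1 (Eventually.of_forall fun s => ?_)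
  rw [Complex.norm_exp_ofReal_mul_I]

lemma abs_integral_cos_le (ρ : Measure ℝ) [IsFiniteMeasure ρ] (t x₀ : ℝ) :
    |∫ s, Real.cos (2 * Real.pi * t * (s - x₀)) ∂ρ| ≤ ‖fourierMass ρ t‖ := by
  have h : ∫ s, Real.cos (2 * Real.pi * t * (s - x₀)) ∂ρ =
      (fourierMass ρ t * Complex.exp (((-(2 * Real.pi * t * x₀) : ℝ) : ℂ) * Complex.I)).re := by
    rw [fourierMass, ← integral_mul_const, ← RCLike.re_eq_complex_re, ← integral_re]
    · congr 1
      ext s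
      rw [← Complex.exp_add, RCLike.re_eq_complex_re, ← add_mul, ← Complex.ofReal_add,
        Complex.exp_ofReal_mul_I_re]
      congr 1; ring
    · exact (integrable_exp_mul_I ρ t).mul_const _
  rw [h]
  refine (Complex.abs_re_le_norm _).trans ?_
  rw [norm_mul, Complex.norm_exp_ofReal_mul_I, mul_one]

lemma tentCoeff_le_rpow {ω : ℝ} (hω : 0 ≤ ω) {n : ℕ} (hn : 0 < n) :
    tentCoeff ω n ≤ 2 * ω ^ (19 / 12 : ℝ) * (n : ℝ) ^ (-(5 / 12) : ℝ) := by
  have h0 := tentCoeff_nonneg ω n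
  have hn' : (0 : ℝ) < n := by exact_mod_cast hn
  calc tentCoeff ω n = tentCoeff ω n ^ (19 / 24 : ℝ) * tentCoeff ω n ^ (5 / 24 : ℝ) := by
        rw [← Real.rpow_add_of_nonneg h0 (by norm_num) (by norm_num)]; norm_num
    _ ≤ (2 * ω ^ 2) ^ (19 / 24 : ℝ) * (2 / (n : ℝ) ^ 2) ^ (5 / 24 : ℝ) := by
        gcongr
        · exact tentCoeff_le_sq ω n
        · exact tentCoeff_le_inv_sq ω hn
    _ = _ := by
        rw [Real.mul_rpow (by norm_num) (by positivity),
            Real.div_rpow (by norm_num) (by positivity),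
          ← Real.rpow_natCast ω 2, ← Real.rpow_natCast (n : ℝ) 2, ← Real.rpow_mul hω,
          ← Real.rpow_mul hn'.le, Real.rpow_neg hn'.le]
        have : (2 : ℝ) ^ (19 / 24 : ℝ) * 2 ^ (5 / 24 : ℝ) = 2 := by
          rw [← Real.rpow_add (by norm_num)]; norm_num
        norm_num
        field_simp
        linear_combination (ω ^ (19 / 12 : ℝ)) * this

/-- The arithmetic weight of the frequency `n` in the sieved sum of tents. -/
def sieveWeight (a b n : ℕ) : ℝ :=
  ∑ q ∈ Finset.Ioc a b, ((if q ∣ n then (q : ℝ) else 0) -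
    ∑ e ∈ q.properDivisors, if e ∣ n then (e : ℝ) else 0)

lemma abs_sieveWeight_le (a b : ℕ) {n : ℕ} (hn : 0 < n) :
    |sieveWeight a b n| ≤ b * n.divisors.card := by
  have h1 : ∀ q ∈ Finset.Ioc a b, |(if q ∣ n then (q : ℝ) else 0) -
      ∑ e ∈ q.properDivisors, if e ∣ n then (e : ℝ) else 0| ≤
      ∑ e ∈ n.divisors, if e ∣ q then (e : ℝ) else 0 := by
    intro q hq
    rw [Finset.mem_Ioc] at hq
    have hq0 : q ≠ 0 := by omega
    have e1 : ∑ e ∈ n.divisors, (if e ∣ q then (e : ℝ) else 0) =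
        ∑ e ∈ q.divisors, if e ∣ n then (e : ℝ) else 0 := by
      rw [← Finset.sum_filter, ← Finset.sum_filter]
      congr 1
      ext e
      simp only [Finset.mem_filter, Nat.mem_divisors]
      constructor
      · rintro ⟨⟨h1, _⟩, h2⟩; exact ⟨⟨h2, hq0⟩, h1⟩
      · rintro ⟨⟨h1, _⟩, h2⟩; exact ⟨⟨h2, hn.ne'⟩, h1⟩
    rw [e1, ← Nat.insert_self_properDivisors hq0, Finset.sum_insert Nat.self_notMem_properDivisors]
    have p1 : 0 ≤ ∑ e ∈ q.properDivisors, (if e ∣ n then (e : ℝ) else 0) :=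
      Finset.sum_nonneg fun e _ => by positivity
    have p2 : (0 : ℝ) ≤ if q ∣ n then (q : ℝ) else 0 := by positivity
    rw [abs_le]
    constructor <;> linarith
  calc |sieveWeight a b n| ≤ _ := (Finset.abs_sum_le_sum_abs _ _).trans (Finset.sum_le_sum h1)
    _ = ∑ e ∈ n.divisors, ∑ q ∈ Finset.Ioc a b, if e ∣ q then (e : ℝ) else 0 :=
      Finset.sum_comm
    _ ≤ ∑ e ∈ n.divisors, (b : ℝ) := by
      refine Finset.sum_le_sum fun e he => ?_
      rw [← Finset.sum_filter, Finset.sum_const, nsmul_eq_mul]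
      have h2 : ((Finset.Ioc a b).filter (e ∣ ·)).card ≤ b / e := by
        rw [← Nat.Ioc_filter_dvd_card_eq_div]
        exact Finset.card_le_card (Finset.filter_subset_filter _
          (Finset.Ioc_subset_Ioc_left (Nat.zero_le _)))
      calc _ ≤ ((b / e : ℕ) : ℝ) * e := by gcongr
        _ ≤ b := by exact_mod_cast Nat.div_mul_le_self b e
    _ = _ := by rw [Finset.sum_const, nsmul_eq_mul, mul_comm]

lemma hasSum_sieveSum {ω : ℝ} (h0 : 0 < ω) (h1 : ω ≤ 1 / 2) (a b : ℕ) (x : ℝ) :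
    HasSum (fun n : ℕ => tentCoeff ω n * sieveWeight a b n * Real.cos (2 * Real.pi * n * x))
      (sieveSum a b ω x - ω ^ 2 * ∑ q ∈ Finset.Ioc a b, ((q : ℝ) - ∑ e ∈ q.properDivisors, (e : ℝ)))
      := by
  have h : ∀ q ∈ Finset.Ioc a b, HasSum (fun n : ℕ =>
      tentCoeff ω n * (if q ∣ n then (q : ℝ) else 0) * Real.cos (2 * Real.pi * n * x) -
      ∑ e ∈ q.properDivisors, tentCoeff ω n * (if e ∣ n then (e : ℝ) else 0) *
        Real.cos (2 * Real.pi * n * x))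
      ((tentSum ω q x - q * ω ^ 2) - ∑ e ∈ q.properDivisors, (tentSum ω e x - e * ω ^ 2)) := by
    intro q hq
    rw [Finset.mem_Ioc] at hq
    refine (hasSum_tentSum h0 h1 (by omega) x).sub (hasSum_sum fun e he => ?_)
    exact hasSum_tentSum h0 h1 (Nat.pos_of_mem_properDivisors he) x
  convert! hasSum_sum h using 1
  · ext n
    rw [sieveWeight, Finset.mul_sum, Finset.sum_mul]
    refine Finset.sum_congr rfl fun q _ => ?_
    rw [mul_sub, sub_mul, Finset.mul_sum, Finset.sum_mul]
  · rw [sieveSum, Finset.mul_sum, ← Finset.sum_sub_distrib]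
    refine Finset.sum_congr rfl fun q _ => ?_
    rw [Finset.sum_sub_distrib, ← Finset.sum_mul]
    ring

lemma tentCoeff_mul_sieveWeight_le {ω : ℝ} (hω : 0 ≤ ω) (a b n : ℕ) :
    |tentCoeff ω n * sieveWeight a b n| ≤
      32 * b * ω ^ (19 / 12 : ℝ) * (n : ℝ) ^ (-(1 / 12) : ℝ) := by
  rcases Nat.eq_zero_or_pos n with rfl | hn
  · simp only [tentCoeff]
    norm_num
  · have hn' : (0 : ℝ) < n := by exact_mod_cast hn
    rw [abs_mul, abs_of_nonneg (tentCoeff_nonneg ω n)]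
    calc _ ≤ (2 * ω ^ (19 / 12 : ℝ) * (n : ℝ) ^ (-(5 / 12) : ℝ)) *
          (b * (16 * (n : ℝ) ^ (1 / 3 : ℝ))) := by
          refine mul_le_mul (tentCoeff_le_rpow hω hn) ((abs_sieveWeight_le a b hn).trans ?_)
            (abs_nonneg _) (by positivity)
          gcongr
          exact card_divisors_le_rpow n
      _ = 32 * b * ω ^ (19 / 12 : ℝ) * ((n : ℝ) ^ (-(5 / 12) : ℝ) * (n : ℝ) ^ (1 / 3 : ℝ)) := by
          ring
      _ = _ := by rw [← Real.rpow_add hn']; norm_num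

lemma summable_tentCoeff_mul_sieveWeight (ω : ℝ) (a b : ℕ) :
    Summable fun n : ℕ => |tentCoeff ω n * sieveWeight a b n| := by
  refine Summable.of_nonneg_of_le (fun _ => abs_nonneg _) (fun n => ?_)
    ((Real.summable_nat_rpow.2 (show (-(5 / 3) : ℝ) < -1 by norm_num)).mul_left (32 * b : ℝ))
  rcases Nat.eq_zero_or_pos n with rfl | hn
  · simp only [tentCoeff]
    norm_num
  · have hn' : (0 : ℝ) < n := by exact_mod_cast hn
    rw [abs_mul, abs_of_nonneg (tentCoeff_nonneg ω n)]
    calc _ ≤ (2 / (n : ℝ) ^ 2) * (b * (16 * (n : ℝ) ^ (1 / 3 : ℝ))) := by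
          refine mul_le_mul (tentCoeff_le_inv_sq ω hn) ((abs_sieveWeight_le a b hn).trans ?_)
            (abs_nonneg _) (by positivity)
          gcongr
          exact card_divisors_le_rpow n
      _ = 32 * b * ((n : ℝ) ^ (-2 : ℝ) * (n : ℝ) ^ (1 / 3 : ℝ)) := by
          rw [Real.rpow_neg hn'.le]; norm_num; ring
      _ = _ := by rw [← Real.rpow_add hn']; norm_num

lemma isOpen_setOf_reducedApprox (a b : ℕ) (x₀ ω : ℝ) : IsOpen {s | ReducedApprox a b x₀ ω s} := by
  have : {s | ReducedApprox a b x₀ ω s} = ⋃ q ∈ Finset.Ioc a b, ⋃ p : ℤ, ⋃ _ : IsCoprime p (q : ℤ),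
      {s | |s - x₀ - p / q| < ω} := by
    ext s; simp [ReducedApprox]
  rw [this]
  refine isOpen_biUnion fun q _ => isOpen_iUnion fun p => isOpen_iUnion fun _ => ?_
  exact isOpen_lt (by fun_prop) continuous_const

lemma measurable_sieveSum (a b : ℕ) (ω : ℝ) : Measurable (sieveSum a b ω) := by
  have h : Measurable (tent ω) := by
    have : tent ω = fun x => max 0 (ω - |x - ((⌊x + 1 / 2⌋ : ℤ) : ℝ)|) := by
      ext x; rw [tent, round_eq]
    rw [this]
    fun_prop
  unfold sieveSum tentSum
  fun_prop

lemma exists_abs_sieveSum_le (a b : ℕ) {ω : ℝ} (hω : 0 ≤ ω) : ∃ C, ∀ x, |sieveSum a b ω x| ≤ C := by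
  have h : ∀ (e : ℕ) (x : ℝ), |tentSum ω e x| ≤ e * ω := by
    intro e x
    rw [tentSum, abs_of_nonneg (Finset.sum_nonneg fun _ _ => tent_nonneg _ _)]
    refine (Finset.sum_le_sum fun _ _ => tent_le hω _).trans ?_
    simp
  refine ⟨∑ q ∈ Finset.Ioc a b, (q * ω + ∑ e ∈ q.properDivisors, e * ω), fun x => ?_⟩
  refine (Finset.abs_sum_le_sum_abs _ _).trans (Finset.sum_le_sum fun q _ => ?_)
  refine (abs_sub _ _).trans (add_le_add (h q x) ?_)
  exact (Finset.abs_sum_le_sum_abs _ _).trans (Finset.sum_le_sum fun e _ => h e x)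

lemma measure_reducedApprox_ge {ω : ℝ} (h0 : 0 < ω) (h1 : ω ≤ 1 / 2) {a b : ℕ}
    (hb : 2 * ω ≤ 1 / (b : ℝ) ^ 2) (x₀ : ℝ) (ρ : Measure ℝ) [IsProbabilityMeasure ρ]
    (hρ : Summable fun n : ℕ => (n : ℝ) ^ (-(1 / 12) : ℝ) * ‖fourierMass ρ n‖) :
    ω ^ 2 * ∑ q ∈ Finset.Ioc a b, ((q : ℝ) - ∑ e ∈ q.properDivisors, (e : ℝ)) -
      32 * b * ω ^ (19 / 12 : ℝ) * ∑' n : ℕ, (n : ℝ) ^ (-(1 / 12) : ℝ) * ‖fourierMass ρ n‖ ≤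
    ω * ρ.real {s | ReducedApprox a b x₀ ω s} := by
  set W := ∑ q ∈ Finset.Ioc a b, ((q : ℝ) - ∑ e ∈ q.properDivisors, (e : ℝ)) with hW
  set F : ℕ → ℝ → ℝ := fun n s =>
    tentCoeff ω n * sieveWeight a b n * Real.cos (2 * Real.pi * n * (s - x₀)) with hF
  have hFint : ∀ n, Integrable (F n) ρ := fun n => by
    refine Integrable.of_bound (by fun_prop) |tentCoeff ω n * sieveWeight a b n|
      (Eventually.of_forall fun s => ?_)
    rw [Real.norm_eq_abs, abs_mul]
    exact mul_le_of_le_one_right (abs_nonneg _) (Real.abs_cos_le_one _)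
  have hsum : Summable fun n => ∫ s, ‖F n s‖ ∂ρ := by
    refine Summable.of_nonneg_of_le (fun n => integral_nonneg fun _ => norm_nonneg _) (fun n => ?_)
      (summable_tentCoeff_mul_sieveWeight ω a b)
    calc ∫ s, ‖F n s‖ ∂ρ ≤ ∫ s, |tentCoeff ω n * sieveWeight a b n| ∂ρ := by
          refine integral_mono (hFint n).norm (integrable_const _) fun s => ?_
          simp only [hF]
          rw [Real.norm_eq_abs, abs_mul]
          exact mul_le_of_le_one_right (abs_nonneg _) (Real.abs_cos_le_one _)
      _ = _ := by simp
  have hI := hasSum_integral_of_summable_integral_norm hFint hsum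
  have htsum : ∀ s, ∑' n, F n s = sieveSum a b ω (s - x₀) - ω ^ 2 * W := fun s =>
    (hasSum_sieveSum h0 h1 a b (s - x₀)).tsum_eq
  simp only [htsum] at hI
  have hbound : ∀ n : ℕ, ‖∫ s, F n s ∂ρ‖ ≤
      32 * b * ω ^ (19 / 12 : ℝ) * ((n : ℝ) ^ (-(1 / 12) : ℝ) * ‖fourierMass ρ n‖) := by
    intro n
    simp only [hF]
    rw [integral_const_mul, norm_mul, Real.norm_eq_abs, Real.norm_eq_abs, ← mul_assoc]
    exact mul_le_mul (tentCoeff_mul_sieveWeight_le h0.le a b n) (abs_integral_cos_le ρ n x₀)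
      (abs_nonneg _) (by positivity)
  have hle := tsum_of_norm_bounded ((hρ.mul_left (32 * b * ω ^ (19 / 12 : ℝ))).hasSum) hbound
  rw [hI.tsum_eq, tsum_mul_left, Real.norm_eq_abs, abs_le] at hle
  have hmeas : MeasurableSet {s | ReducedApprox a b x₀ ω s} :=
    (isOpen_setOf_reducedApprox a b x₀ ω).measurableSet
  have hfin : ∫ s, (sieveSum a b ω (s - x₀) - ω ^ 2 * W) ∂ρ ≤
      ω * ρ.real {s | ReducedApprox a b x₀ ω s} - ω ^ 2 * W := by
    have hi2 : Integrable (Set.indicator {s | ReducedApprox a b x₀ ω s} fun _ => ω) ρ :=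
      (integrable_const ω).indicator hmeas
    calc _ ≤ ∫ s, (Set.indicator {s | ReducedApprox a b x₀ ω s} (fun _ => ω) s - ω ^ 2 * W) ∂ρ := by
          refine integral_mono ?_ (hi2.sub (integrable_const _)) fun s => ?_
          · refine Integrable.sub ?_ (integrable_const _)
            obtain ⟨C, hC⟩ := exists_abs_sieveSum_le a b h0.le
            exact Integrable.of_bound ((measurable_sieveSum a b ω).comp
              (measurable_id.sub_const x₀)).aestronglyMeasurable C (Eventually.of_forall fun s =>
                  hC _)
          · exact sub_le_sub_right (sieveSum_le_indicator h0.le hb x₀ s) _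
      _ = _ := by
        rw [integral_sub hi2 (integrable_const _), integral_indicator_const _ hmeas]
        simp [mul_comm]
  linarith [hle.1]

lemma eventually_measure_reducedApprox {τ R₀ : ℝ} (hτ : 0 < τ) (hτ' : τ ≤ 1 / 20) (hR : 1 ≤ R₀)
    (ρ : Measure ℝ) [IsProbabilityMeasure ρ]
    (hρ : Summable fun n : ℕ => (n : ℝ) ^ (-(1 / 12) : ℝ) * ‖fourierMass ρ n‖) :
    ∀ᶠ Q : ℝ in atTop, τ ^ 2 / (40 * R₀) ≤ ρ.real {s |
      ReducedApprox ⌊Q⌋₊ ⌊(1 + τ) * Q⌋₊ (1 / (R₀ * Q ^ 2)) (τ / (R₀ * Q ^ 2)) s} := by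
  set Z := ∑' n : ℕ, (n : ℝ) ^ (-(1 / 12) : ℝ) * ‖fourierMass ρ n‖ with hZ
  have hZ0 : 0 ≤ Z := tsum_nonneg fun n => by positivity
  have hsmall : ∀ᶠ Q : ℝ in atTop,
      64 * (τ / R₀) ^ (7 / 12 : ℝ) * Z * Q ^ (-(1 / 6) : ℝ) < τ ^ 2 / (40 * R₀) := by
    have h := (tendsto_rpow_neg_atTop (show (0 : ℝ) < 1 / 6 by norm_num)).const_mul
      (64 * (τ / R₀) ^ (7 / 12 : ℝ) * Z)
    rw [mul_zero] at h
    exact h.eventually (gt_mem_nhds (by positivity))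
  filter_upwards [hsmall, eventually_sum_sub_properDivisors hτ hτ', eventually_ge_atTop (2 : ℝ)]
    with Q h1 h2 h3
  set a := ⌊Q⌋₊
  set b := ⌊(1 + τ) * Q⌋₊ with hb
  set ω := τ / (R₀ * Q ^ 2) with hω
  have hQ0 : (0 : ℝ) < Q := by linarith
  have hRp : (0 : ℝ) < R₀ := by linarith
  have hω0 : 0 < ω := by positivity
  have hb1 : (b : ℝ) ≤ 21 / 20 * Q := (Nat.floor_le (by positivity)).trans (by nlinarith)
  have hb0 : (0 : ℝ) < b := by
    have : 0 < b := Nat.floor_pos.2 (by nlinarith)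
    exact_mod_cast this
  have hωQ : ω ≤ 1 / (20 * Q ^ 2) := by
    rw [hω, div_le_div_iff₀ (by positivity) (by positivity)]
    nlinarith [mul_le_mul hτ' hR (by norm_num) (by norm_num), sq_nonneg Q]
  have hω1 : ω ≤ 1 / 2 := hωQ.trans (by
    rw [div_le_div_iff₀ (by positivity) (by positivity)]; nlinarith)
  have hω2 : 2 * ω ≤ 1 / (b : ℝ) ^ 2 := by
    calc 2 * ω ≤ 2 * (1 / (20 * Q ^ 2)) := by linarith
      _ = 1 / (10 * Q ^ 2) := by field_simp; norm_num
      _ ≤ _ := by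
        apply one_div_le_one_div_of_le (by positivity)
        nlinarith
  have key := measure_reducedApprox_ge hω0 hω1 hω2 (a := a) (1 / (R₀ * Q ^ 2)) ρ hρ
  have hpow : ω ^ (19 / 12 : ℝ) = ω * ((τ / R₀) ^ (7 / 12 : ℝ) * Q ^ (-(7 / 6) : ℝ)) := by
    have e1 : ω ^ (19 / 12 : ℝ) = ω * ω ^ (7 / 12 : ℝ) := by
      rw [← Real.rpow_one_add' hω0.le (by norm_num)]; norm_num
    have e2 : ω = (τ / R₀) * Q ^ (-2 : ℝ) := by
      rw [hω, Real.rpow_neg hQ0.le]; norm_num; field_simp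
    rw [e1]
    congr 1
    rw [e2, Real.mul_rpow (by positivity) (by positivity), ← Real.rpow_mul hQ0.le]
    norm_num
  have hQpow : Q * Q ^ (-(7 / 6) : ℝ) = Q ^ (-(1 / 6) : ℝ) := by
    rw [← Real.rpow_one_add' hQ0.le (by norm_num)]; norm_num
  rw [hpow] at key
  have key2 : ω * (ω * (τ / 20 * Q ^ 2) - 64 * (τ / R₀) ^ (7 / 12 : ℝ) * Z * Q ^ (-(1 / 6) : ℝ)) ≤
      ω * ρ.real {s | ReducedApprox a b (1 / (R₀ * Q ^ 2)) ω s} := by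
    refine le_trans ?_ key
    have e1 : ω * (64 * (τ / R₀) ^ (7 / 12 : ℝ) * Z * Q ^ (-(1 / 6) : ℝ)) =
        32 * (2 * Q) * (ω * ((τ / R₀) ^ (7 / 12 : ℝ) * Q ^ (-(7 / 6) : ℝ))) * Z := by
      rw [← hQpow]; ring
    have e2 : 32 * (b : ℝ) * (ω * ((τ / R₀) ^ (7 / 12 : ℝ) * Q ^ (-(7 / 6) : ℝ))) * Z ≤
        32 * (2 * Q) * (ω * ((τ / R₀) ^ (7 / 12 : ℝ) * Q ^ (-(7 / 6) : ℝ))) * Z := by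
      gcongr; linarith
    have e3 := mul_le_mul_of_nonneg_left h2 (sq_nonneg ω)
    rw [mul_sub, e1]
    linarith
  have key3 := le_of_mul_le_mul_left key2 hω0
  have e4 : ω * (τ / 20 * Q ^ 2) = τ ^ 2 / (40 * R₀) + τ ^ 2 / (40 * R₀) := by
    rw [hω]; field_simp; norm_num
  linarith

/-- Prepend a term to a sequence. -/
def consSeq {α : Type*} (d : α) (y : ℕ → α) : ℕ → α
  | 0 => d
  | k + 1 => y k

/-- The sequence which agrees with `ω` before time `m` and continues with `y`. -/
def glueSeq {α : Type*} (m : ℕ) (ω y : ℕ → α) : ℕ → α :=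
  fun k => if k < m then ω k else y (k - m)

lemma glueSeq_zero {α : Type*} (ω y : ℕ → α) : glueSeq 0 ω y = y := by
  ext k; simp [glueSeq]

lemma glueSeq_succ {α : Type*} (m : ℕ) (ω y : ℕ → α) :
    glueSeq (m + 1) ω y = consSeq (ω 0) (glueSeq m (fun k => ω (k + 1)) y) := by
  ext k
  cases k with
  | zero => simp [glueSeq, consSeq]
  | succ k => simp [glueSeq, consSeq]

lemma measurable_consSeq {α : Type*} [MeasurableSpace α] (d : α) :
    Measurable (consSeq d) := by
  refine measurable_pi_lambda _ fun k => ?_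
  cases k with
  | zero => exact measurable_const
  | succ k => exact measurable_pi_apply k

lemma measurable_glueSeq {α : Type*} [MeasurableSpace α] (m : ℕ) (ω : ℕ → α) :
    Measurable (glueSeq m ω) := by
  refine measurable_pi_lambda _ fun k => ?_
  unfold glueSeq
  split_ifs
  · exact measurable_const
  · exact measurable_pi_apply _

/-- The uniform distribution on a finite set of digits. -/
def digitUniform (D : Finset ℕ) : Measure D := (D.card : ℝ≥0∞)⁻¹ • Measure.count

instance (D : Finset ℕ) [Nonempty D] : IsProbabilityMeasure (digitUniform D) := by
  constructor
  have h : D.card ≠ 0 := (Finset.card_pos.2 (Finset.nonempty_coe_sort.1 ‹_›)).ne'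
  simp only [digitUniform, Measure.smul_apply, smul_eq_mul, Measure.count_univ]
  rw [ENat.card_eq_coe_fintype_card, Fintype.card_coe]
  exact ENNReal.inv_mul_cancel (by exact_mod_cast h) (by simp)

/-- The law of a sequence of independent uniform digits. -/
def digitMeasure (D : Finset ℕ) [Nonempty D] : Measure (ℕ → D) :=
  Measure.infinitePi fun _ => digitUniform D

instance (D : Finset ℕ) [Nonempty D] : IsProbabilityMeasure (digitMeasure D) := by
  unfold digitMeasure; infer_instance

lemma digitMeasure_eq_sum (D : Finset ℕ) [Nonempty D] :
    digitMeasure D = (D.card : ℝ≥0∞)⁻¹ • ∑ d : D, (digitMeasure D).map (consSeq d) := by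
  symm
  refine Measure.eq_infinitePi _ fun s t ht => ?_
  set t' : ℕ → Set D := fun i => if i ∈ s then t i else Set.univ with ht'
  have ht'm : ∀ i, MeasurableSet (t' i) := fun i => by
    simp only [ht']; split_ifs
    · exact ht i
    · exact MeasurableSet.univ
  obtain ⟨n, hn⟩ : ∃ n, s ⊆ Finset.range (n + 1) := by
    refine ⟨s.sup id, fun i hi => ?_⟩
    rw [Finset.mem_range, Nat.lt_succ_iff]
    exact Finset.le_sup (f := id) hi
  have hpi : Set.pi (s : Set ℕ) t = Set.pi (Finset.range (n + 1) : Set ℕ) t' := by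
    ext y
    simp only [Set.mem_pi, ht']
    constructor
    · intro h i _
      split_ifs with hi
      · exact h i hi
      · trivial
    · intro h i hi
      have := h i (hn hi)
      rwa [if_pos (by exact_mod_cast hi)] at this
  have hprod : ∏ i ∈ s, digitUniform D (t i) = ∏ i ∈ Finset.range (n + 1),
      digitUniform D (t' i) := by
    rw [← Finset.prod_subset hn]
    · exact Finset.prod_congr rfl fun i hi => by simp only [ht', if_pos hi]
    · intro i _ hi
      simp only [ht', if_neg hi, measure_univ]
  have hm : MeasurableSet (Set.pi (Finset.range (n + 1) : Set ℕ) t') :=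
    MeasurableSet.pi (Set.to_countable _) fun i _ => ht'm i
  have hcons : ∀ d : D,
      (digitMeasure D).map (consSeq d) (Set.pi (Finset.range (n + 1) : Set ℕ) t') =
      Set.indicator (t' 0) 1 d * ∏ i ∈ Finset.range n, digitUniform D (t' (i + 1)) := by
    intro d
    rw [Measure.map_apply (measurable_consSeq d) hm]
    have hiff : ∀ y, y ∈ consSeq d ⁻¹' Set.pi (Finset.range (n + 1) : Set ℕ) t' ↔
        d ∈ t' 0 ∧ y ∈ Set.pi (Finset.range n : Set ℕ) fun i => t' (i + 1) := by
      intro y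
      simp only [Set.mem_preimage, Set.mem_pi, Finset.coe_range, Set.mem_Iio]
      constructor
      · exact fun h => ⟨h 0 (Nat.succ_pos n), fun i hi => h (i + 1) (Nat.succ_lt_succ hi)⟩
      · rintro ⟨h0, h⟩ i hi
        cases i with
        | zero => exact h0
        | succ i => exact h i (Nat.lt_of_succ_lt_succ hi)
    by_cases hd : d ∈ t' 0
    · rw [Set.indicator_of_mem hd, Pi.one_apply, one_mul,
        ← Measure.infinitePi_pi (μ := fun _ : ℕ => digitUniform D) (s := Finset.range n)
          (t := fun i => t' (i + 1)) (fun i _ => ht'm _)]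
      rw [digitMeasure]
      congr 1
      ext y
      rw [hiff]
      simp [hd]
    · rw [Set.indicator_of_notMem hd, zero_mul]
      convert! measure_empty (μ := digitMeasure D)
      ext y
      rw [hiff]
      simp [hd]
  rw [hpi, hprod, Measure.smul_apply, Measure.finsetSum_apply,
      Finset.sum_congr rfl fun d _ => hcons d,
    ← Finset.sum_mul, Finset.prod_range_succ', mul_comm _ (digitUniform D (t' 0)), smul_eq_mul,
    ← mul_assoc]
  congr 1
  rw [digitUniform, Measure.smul_apply, smul_eq_mul, Measure.count_apply (ht'm 0)]
  congr 1
  rw [← tsum_fintype (L := .unconditional D), ← tsum_subtype]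
  simp

lemma digitMeasure_apply (D : Finset ℕ) [Nonempty D] {A : Set (ℕ → D)} (hA : MeasurableSet A) :
    digitMeasure D A = (D.card : ℝ≥0∞)⁻¹ * ∑ d : D, digitMeasure D (consSeq d ⁻¹' A) := by
  conv_lhs => rw [digitMeasure_eq_sum]
  rw [Measure.smul_apply, Measure.finsetSum_apply, smul_eq_mul]
  congr 1
  exact Finset.sum_congr rfl fun d _ => Measure.map_apply (measurable_consSeq d) hA

lemma measurableSet_cylinder {D : Finset ℕ} (ω : ℕ → D) (m : ℕ) :
    MeasurableSet (PiNat.cylinder ω m) := by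
  rw [PiNat.cylinder_eq_pi]
  exact MeasurableSet.pi (Set.to_countable _) fun i _ => MeasurableSet.singleton _

lemma digitMeasure_cylinder_inter (D : Finset ℕ) [Nonempty D] (m : ℕ) (ω : ℕ → D)
    {A : Set (ℕ → D)} (hA : MeasurableSet A) :
    digitMeasure D (PiNat.cylinder ω m ∩ A) =
      (D.card : ℝ≥0∞)⁻¹ ^ m * digitMeasure D (glueSeq m ω ⁻¹' A) := by
  induction m generalizing ω A with
  | zero =>
    have : glueSeq 0 ω = id := by ext1 y; exact glueSeq_zero ω y
    rw [this]; simp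
  | succ m ih =>
    rw [digitMeasure_apply D ((measurableSet_cylinder ω _).inter hA),
      Finset.sum_eq_single_of_mem (ω 0) (Finset.mem_univ _)]
    · have h1 : consSeq (ω 0) ⁻¹' (PiNat.cylinder ω (m + 1) ∩ A) =
          PiNat.cylinder (fun k => ω (k + 1)) m ∩ consSeq (ω 0) ⁻¹' A := by
        ext y
        simp only [Set.mem_preimage, Set.mem_inter_iff, PiNat.mem_cylinder_iff]
        refine and_congr_left fun _ => ⟨fun h i hi => h (i + 1) (by omega), fun h i hi => ?_⟩
        cases i with
        | zero => rfl
        | succ i => exact h i (by omega)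
      rw [h1, ih _ (measurable_consSeq _ hA), pow_succ', mul_assoc, ← Set.preimage_comp]
      congr 4
      ext1 y
      exact (glueSeq_succ m ω y).symm
    · intro d _ hd
      convert! measure_empty (μ := digitMeasure D)
      ext y
      simp only [Set.mem_preimage, Set.mem_inter_iff, PiNat.mem_cylinder_iff,
          Set.mem_empty_iff_false,
        iff_false, not_and]
      intro h
      exact absurd (h 0 (Nat.succ_pos m)) hd

lemma digitMeasure_cylinder (D : Finset ℕ) [Nonempty D] (m : ℕ) (ω : ℕ → D) :
    digitMeasure D (PiNat.cylinder ω m) = (D.card : ℝ≥0∞)⁻¹ ^ m := by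
  have := digitMeasure_cylinder_inter D m ω MeasurableSet.univ
  simpa using this

/-- The real number with base `N` expansion `ω`. -/
def digitExpand (N : ℕ) {D : Finset ℕ} (ω : ℕ → D) : ℝ := ∑' k, ((ω k : ℕ) : ℝ) / (N : ℝ) ^ (k + 1)

section Expand

variable {N : ℕ} {D : Finset ℕ}

lemma hasSum_geometric_digits (hN : 2 ≤ N) :
    HasSum (fun k : ℕ => ((N : ℝ) - 1) / (N : ℝ) ^ (k + 1)) 1 := by
  have hN' : (2 : ℝ) ≤ N := by exact_mod_cast hN
  have h := (hasSum_geometric_of_lt_one (r := (N : ℝ)⁻¹) (by positivity)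
    (inv_lt_one_of_one_lt₀ (by linarith))).mul_left (((N : ℝ) - 1) / N)
  convert! h using 1
  · ext k; rw [pow_succ, inv_pow]; field_simp
  · have : (N : ℝ) - 1 ≠ 0 := by linarith
    field_simp

lemma digit_term_le (hD : ∀ d ∈ D, d < N) (ω : ℕ → D) (k : ℕ) :
    ((ω k : ℕ) : ℝ) / (N : ℝ) ^ (k + 1) ≤ ((N : ℝ) - 1) / (N : ℝ) ^ (k + 1) := by
  have h := hD _ (ω k).2
  have : ((ω k : ℕ) : ℝ) + 1 ≤ N := by exact_mod_cast h
  gcongr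
  linarith

lemma summable_digitExpand (hN : 2 ≤ N) (hD : ∀ d ∈ D, d < N) (ω : ℕ → D) :
    Summable fun k => ((ω k : ℕ) : ℝ) / (N : ℝ) ^ (k + 1) :=
  Summable.of_nonneg_of_le (fun _ => by positivity) (digit_term_le hD ω)
    (hasSum_geometric_digits hN).summable

lemma digitExpand_nonneg (ω : ℕ → D) : 0 ≤ digitExpand N ω := tsum_nonneg fun _ => by positivity

lemma digitExpand_le_one (hN : 2 ≤ N) (hD : ∀ d ∈ D, d < N) (ω : ℕ → D) : digitExpand N ω ≤ 1 := by
  rw [← (hasSum_geometric_digits hN).tsum_eq]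
  exact (summable_digitExpand hN hD ω).tsum_le_tsum (digit_term_le hD ω)
    (hasSum_geometric_digits hN).summable

lemma continuous_digitExpand (hN : 2 ≤ N) (hD : ∀ d ∈ D, d < N) :
    Continuous (digitExpand N : (ℕ → D) → ℝ) := by
  refine continuous_tsum (fun k => ?_) (hasSum_geometric_digits hN).summable fun k ω => ?_
  · have : Continuous fun d : D => ((d : ℕ) : ℝ) := continuous_of_discreteTopology
    exact (this.comp (continuous_apply k)).div_const _
  · rw [Real.norm_of_nonneg (by positivity)]
    exact digit_term_le hD ω k

lemma digitExpand_consSeq (hN : 2 ≤ N) (hD : ∀ d ∈ D, d < N) (d : D) (y : ℕ → D) :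
    digitExpand N (consSeq d y) = ((d : ℕ) + digitExpand N y) / N := by
  rw [digitExpand, (summable_digitExpand hN hD _).tsum_eq_zero_add, add_div]
  simp only [consSeq, zero_add, pow_one]
  congr 1
  rw [digitExpand, ← tsum_div_const]
  congr 1; ext k
  rw [pow_succ _ (k + 1), div_div]

lemma digitExpand_glueSeq (hN : 2 ≤ N) (hD : ∀ d ∈ D, d < N) (m : ℕ) (ω : ℕ → D) :
    ∃ u : ℝ, ∀ y, digitExpand N (glueSeq m ω y) = u + digitExpand N y / N ^ m := by
  induction m generalizing ω with
  | zero => exact ⟨0, fun y => by simp [glueSeq_zero]⟩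
  | succ m ih =>
    obtain ⟨u, hu⟩ := ih fun k => ω (k + 1)
    refine ⟨((ω 0 : ℕ) + u) / N, fun y => ?_⟩
    rw [glueSeq_succ, digitExpand_consSeq hN hD, hu, pow_succ]
    field_simp
    ring

lemma glueSeq_eq_of_mem_cylinder {α : Type*} {m : ℕ} {ω z : ℕ → α} (h : z ∈ PiNat.cylinder ω m) :
    glueSeq m ω (fun k => z (k + m)) = z := by
  ext1 k
  rw [PiNat.mem_cylinder_iff] at h
  unfold glueSeq
  split_ifs with hk
  · exact (h k hk).symm
  · simp only; congr 1; omega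

lemma abs_digitExpand_sub_le (hN : 2 ≤ N) (hD : ∀ d ∈ D, d < N) {m : ℕ} {ω z : ℕ → D}
    (h : z ∈ PiNat.cylinder ω m) : |digitExpand N ω - digitExpand N z| ≤ 1 / (N : ℝ) ^ m := by
  obtain ⟨u, hu⟩ := digitExpand_glueSeq hN hD m ω
  rw [← glueSeq_eq_of_mem_cylinder h, ← glueSeq_eq_of_mem_cylinder (PiNat.self_mem_cylinder ω m),
    hu, glueSeq_eq_of_mem_cylinder (PiNat.self_mem_cylinder ω m), hu, add_sub_add_left_eq_sub,
    ← sub_div, abs_div, abs_of_nonneg (show (0 : ℝ) ≤ (N : ℝ) ^ m by positivity)]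
  gcongr
  rw [abs_le]
  constructor <;> linarith [digitExpand_nonneg (N := N) (fun k => ω (k + m)),
    digitExpand_nonneg (N := N) (fun k => z (k + m)), digitExpand_le_one hN hD (fun k => ω (k + m)),
    digitExpand_le_one hN hD (fun k => z (k + m))]

end Expand

lemma sum_range_mul_eq {M : Type*} [AddCommMonoid M] (f : ℕ → M) (m k : ℕ) :
    ∑ n ∈ Finset.range (m * k), f n =
      ∑ r ∈ Finset.range m, ∑ a ∈ Finset.range k, f (r + m * a) := by
  induction k with
  | zero => simp
  | succ k ih =>
    simp_rw [Finset.sum_range_succ]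
    rw [Finset.sum_add_distrib, ← ih, mul_add_one, Finset.sum_range_add]
    simp_rw [add_comm]

lemma norm_fourierMass_le_one (ρ : Measure ℝ) [IsProbabilityMeasure ρ] (t : ℝ) :
    ‖fourierMass ρ t‖ ≤ 1 := by
  refine (norm_integral_le_integral_norm _).trans ?_
  simp only [Complex.norm_exp_ofReal_mul_I]
  simp

/-- The Fourier transform of the uniform distribution on the digits. -/
def digitSymbol (D : Finset ℕ) (x : ℝ) : ℂ :=
  (D.card : ℂ)⁻¹ * ∑ d ∈ D, Complex.exp (((2 * Real.pi * x * d : ℝ) : ℂ) * Complex.I)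

lemma digitSymbol_add_nat (D : Finset ℕ) (x : ℝ) (a : ℕ) :
    digitSymbol D (x + a) = digitSymbol D x := by
  unfold digitSymbol
  congr 1
  refine Finset.sum_congr rfl fun d _ => ?_
  rw [Complex.exp_eq_exp_iff_exists_int]
  refine ⟨(a * d : ℕ), ?_⟩
  push_cast
  ring

lemma norm_geom_sum_exp_le {N : ℕ} {x : ℝ} (hx : x ∈ Set.Ico (0 : ℝ) 1) {a : ℕ} (ha : a < N) :
    ‖∑ d ∈ Finset.range N,
      Complex.exp (((2 * Real.pi * ((x + a) / N) * d : ℝ) : ℂ) * Complex.I)‖ ≤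
      N / (a + 1) + N / (N - a) := by
  have hN : (0 : ℝ) < N := by exact_mod_cast (Nat.zero_le a).trans_lt ha
  have haN : (a : ℝ) + 1 ≤ N := by exact_mod_cast ha
  have ha0 : (0 : ℝ) ≤ a := by positivity
  have p1 : (0 : ℝ) ≤ N / (a + 1) := by positivity
  have p2 : (0 : ℝ) ≤ N / (N - a) := div_nonneg hN.le (by linarith)
  have htriv : ‖∑ d ∈ Finset.range N,
      Complex.exp (((2 * Real.pi * ((x + a) / N) * d : ℝ) : ℂ) * Complex.I)‖ ≤ N := by
    refine (norm_sum_le _ _).trans ?_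
    simp only [Complex.norm_exp_ofReal_mul_I]
    simp
  rcases Nat.eq_zero_or_pos a with rfl | ha1
  · refine htriv.trans ?_
    simp only [Nat.cast_zero, zero_add, div_one]
    simp only [Nat.cast_zero] at p2
    linarith
  rcases Nat.eq_or_lt_of_le (Nat.succ_le_of_lt ha) with h | ha2
  · refine htriv.trans ?_
    have : (N : ℝ) - a = 1 := by rw [← h]; push_cast; ring
    rw [this, div_one]
    linarith
  have ha1' : (1 : ℝ) ≤ a := by exact_mod_cast ha1
  have ha2' : (a : ℝ) + 2 ≤ N := by exact_mod_cast ha2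
  set y := (x + a) / N with hy
  have hy0 : 0 < y := div_pos (by linarith [hx.1]) hN
  have hy1 : y < 1 := by rw [hy, div_lt_one hN]; linarith [hx.2]
  set ζ := Complex.exp (Complex.I * ((2 * Real.pi * y : ℝ) : ℂ)) with hζ
  have hsum : ∑ d ∈ Finset.range N,
      Complex.exp (((2 * Real.pi * y * d : ℝ) : ℂ) * Complex.I) = ∑ d ∈ Finset.range N, ζ ^ d := by
    refine Finset.sum_congr rfl fun d _ => ?_
    rw [hζ, ← Complex.exp_nat_mul]
    congr 1; push_cast; ring
  have hgeom := congrArg norm (geom_sum_mul ζ N)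
  rw [norm_mul] at hgeom
  have hζ1 : ‖ζ‖ = 1 := by rw [hζ, mul_comm, Complex.norm_exp_ofReal_mul_I]
  have h2 : ‖ζ ^ N - 1‖ ≤ 2 := by
    refine (norm_sub_le _ _).trans ?_
    rw [norm_pow, hζ1]; norm_num
  have h3 : ‖ζ - 1‖ = |2 * Real.sin (Real.pi * y)| := by
    rw [hζ, Complex.norm_exp_I_mul_ofReal_sub_one, Real.norm_eq_abs]
    congr 3; ring
  rw [hsum]
  have hpi := Real.pi_pos
  rcases le_total y (1 / 2) with h | h
  · have hs : 2 * y ≤ Real.sin (Real.pi * y) := by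
      have := Real.mul_le_sin (x := Real.pi * y) (by positivity) (by nlinarith)
      calc 2 * y = 2 / Real.pi * (Real.pi * y) := by field_simp
        _ ≤ _ := this
    rw [h3, abs_of_nonneg (by linarith)] at hgeom
    have h4 : ‖∑ d ∈ Finset.range N, ζ ^ d‖ * (4 * y) ≤ 2 :=
      (mul_le_mul_of_nonneg_left (by linarith) (norm_nonneg _)).trans (hgeom.trans_le h2)
    have h5 : (a + 1 : ℝ) / N ≤ 2 * y := by
      rw [hy, ← mul_div_assoc]; gcongr; linarith [hx.1]
    have h6 : ‖∑ d ∈ Finset.range N, ζ ^ d‖ ≤ N / (a + 1) := by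
      rw [le_div_iff₀ (by positivity)]
      rw [div_le_iff₀ hN] at h5
      nlinarith [norm_nonneg (∑ d ∈ Finset.range N, ζ ^ d)]
    linarith
  · have hs : 2 * (1 - y) ≤ Real.sin (Real.pi * y) := by
      have := Real.mul_le_sin (x := Real.pi * (1 - y)) (mul_nonneg hpi.le (by linarith))
        (by nlinarith)
      rw [← Real.sin_pi_sub (Real.pi * y), ← mul_one_sub]
      calc 2 * (1 - y) = 2 / Real.pi * (Real.pi * (1 - y)) := by field_simp
        _ ≤ _ := this
    rw [h3, abs_of_nonneg (by linarith)] at hgeom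
    have h4 : ‖∑ d ∈ Finset.range N, ζ ^ d‖ * (4 * (1 - y)) ≤ 2 :=
      (mul_le_mul_of_nonneg_left (by linarith) (norm_nonneg _)).trans (hgeom.trans_le h2)
    have h5 : (N - a : ℝ) ≤ 2 * (1 - y) * N := by
      have : y * N = x + a := by rw [hy]; field_simp
      nlinarith [hx.2]
    have h6 : ‖∑ d ∈ Finset.range N, ζ ^ d‖ ≤ N / (N - a) := by
      rw [le_div_iff₀ (by linarith)]
      nlinarith [norm_nonneg (∑ d ∈ Finset.range N, ζ ^ d)]
    linarith

/-- The constant bounding the averaged digit symbol. -/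
def symbolBound (N : ℕ) (D : Finset ℕ) : ℝ :=
  2 * (2 * (1 + Real.log N) + (Finset.range N \ D).card)

lemma sum_inv_reflect_le (N : ℕ) :
    ∑ a ∈ Finset.range N, ((N : ℝ) / (a + 1) + N / (N - a)) ≤ N * (2 * (1 + Real.log N)) := by
  have h1 : ∑ a ∈ Finset.range N, (N : ℝ) / (a + 1) ≤ N * (1 + Real.log N) := by
    have := harmonic_le_one_add_log N
    rw [harmonic] at this
    push_cast at this
    calc _ = N * ∑ a ∈ Finset.range N, ((a : ℝ) + 1)⁻¹ := by
          rw [Finset.mul_sum]; rfl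
      _ ≤ _ := by gcongr
  have h2 : ∑ a ∈ Finset.range N, (N : ℝ) / (N - a) = ∑ a ∈ Finset.range N, (N : ℝ) / (a + 1) := by
    rw [← Finset.sum_range_reflect]
    refine Finset.sum_congr rfl fun a ha => ?_
    rw [Finset.mem_range] at ha
    rw [Nat.sub_sub, Nat.cast_sub (by omega)]
    push_cast
    congr 1; ring
  rw [Finset.sum_add_distrib, h2]
  linarith

lemma sum_norm_digitSymbol_le {N : ℕ} {D : Finset ℕ} (hN : 2 ≤ N) (hD : ∀ d ∈ D, d < N)
    (hcard : N ≤ 2 * D.card) {x : ℝ} (hx : x ∈ Set.Ico (0 : ℝ) 1) :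
    ∑ a ∈ Finset.range N, ‖digitSymbol D ((x + a) / N)‖ ≤ symbolBound N D := by
  have hsub : D ⊆ Finset.range N := fun d hd => Finset.mem_range.2 (hD d hd)
  have hc : (0 : ℝ) < D.card := by exact_mod_cast (by omega : 0 < D.card)
  have hcard' : (N : ℝ) ≤ 2 * D.card := by exact_mod_cast hcard
  have hterm : ∀ a ∈ Finset.range N, ‖digitSymbol D ((x + a) / N)‖ ≤
      (D.card : ℝ)⁻¹ * (((N : ℝ) / (a + 1) + N / (N - a)) + (Finset.range N \ D).card) := by
    intro a ha
    rw [Finset.mem_range] at ha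
    rw [digitSymbol, norm_mul, norm_inv, Complex.norm_natCast]
    gcongr
    have e : ∑ d ∈ D, Complex.exp (((2 * Real.pi * ((x + a) / N) * d : ℝ) : ℂ) * Complex.I) =
        ∑ d ∈ Finset.range N,
            Complex.exp (((2 * Real.pi * ((x + a) / N) * d : ℝ) : ℂ) * Complex.I) -
        ∑ d ∈ Finset.range N \ D,
          Complex.exp (((2 * Real.pi * ((x + a) / N) * d : ℝ) : ℂ) * Complex.I) := by
      rw [← Finset.sum_sdiff hsub]; ring
    rw [e]
    refine (norm_sub_le _ _).trans (add_le_add (norm_geom_sum_exp_le hx ha) ?_)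
    refine (norm_sum_le _ _).trans ?_
    simp only [Complex.norm_exp_ofReal_mul_I]
    simp
  refine (Finset.sum_le_sum hterm).trans ?_
  rw [← Finset.mul_sum, Finset.sum_add_distrib, Finset.sum_const, Finset.card_range, nsmul_eq_mul,
    inv_mul_le_iff₀ hc, symbolBound]
  have h1 := sum_inv_reflect_le N
  have h2 : (0 : ℝ) ≤ 2 * (1 + Real.log N) + (Finset.range N \ D).card := by
    have := Real.log_natCast_nonneg N
    positivity
  nlinarith

section Decay

variable {N : ℕ} {D : Finset ℕ} [Nonempty D]

lemma fourierMass_digit (hN : 2 ≤ N) (hD : ∀ d ∈ D, d < N) (t : ℝ) :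
    fourierMass ((digitMeasure D).map (digitExpand N)) t =
      digitSymbol D (t / N) * fourierMass ((digitMeasure D).map (digitExpand N)) (t / N) := by
  have hm : Measurable (digitExpand N : (ℕ → D) → ℝ) := (continuous_digitExpand hN hD).measurable
  have hN0 : (N : ℝ) ≠ 0 := by positivity
  unfold fourierMass
  rw [integral_map hm.aemeasurable (by fun_prop), integral_map hm.aemeasurable (by fun_prop)]
  set f : (ℕ → D) → ℂ := fun ω =>
    Complex.exp (((2 * Real.pi * t * digitExpand N ω : ℝ) : ℂ) * Complex.I) with hf
  have hfm : Measurable f := by fun_prop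
  have hfint : ∀ (μ : Measure (ℕ → D)) [IsFiniteMeasure μ], Integrable f μ := fun μ _ =>
    Integrable.of_bound hfm.aestronglyMeasurable 1 (Eventually.of_forall fun ω => by
      simp only [hf]; rw [Complex.norm_exp_ofReal_mul_I])
  change ∫ ω, f ω ∂_ = _
  rw [digitMeasure_eq_sum, integral_smul_measure, integral_finsetSum_measure fun d _ => ?_]
  · rw [← digitMeasure_eq_sum, digitSymbol, mul_assoc, Finset.sum_mul, ← Finset.sum_coe_sort D,
      ENNReal.toReal_inv, ENNReal.toReal_natCast, Complex.real_smul]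
    push_cast
    congr 1
    refine Finset.sum_congr rfl fun d _ => ?_
    rw [integral_map (measurable_consSeq d).aemeasurable hfm.aestronglyMeasurable,
      ← integral_const_mul]
    congr 1
    ext y
    simp only [hf]
    rw [digitExpand_consSeq hN hD, ← Complex.exp_add]
    congr 1
    push_cast
    field_simp
  · have := Measure.isFiniteMeasure_map (digitMeasure D) (consSeq d)
    exact hfint _

lemma sum_norm_fourierMass_le (hN : 2 ≤ N) (hD : ∀ d ∈ D, d < N) (hcard : N ≤ 2 * D.card)
    (L : ℕ) {x : ℝ} (hx : x ∈ Set.Ico (0 : ℝ) 1) :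
    ∑ a ∈ Finset.range (N ^ L), ‖fourierMass ((digitMeasure D).map (digitExpand N)) (x + a)‖ ≤
      symbolBound N D ^ L := by
  have hm : Measurable (digitExpand N : (ℕ → D) → ℝ) := (continuous_digitExpand hN hD).measurable
  have := Measure.isProbabilityMeasure_map (μ := digitMeasure D) hm.aemeasurable
  have hN0 : (0 : ℝ) < N := by positivity
  induction L generalizing x with
  | zero => simpa using norm_fourierMass_le_one _ _
  | succ L ih =>
    rw [pow_succ', sum_range_mul_eq, pow_succ']
    have hterm : ∀ r ∈ Finset.range N, ∑ a ∈ Finset.range (N ^ L),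
        ‖fourierMass ((digitMeasure D).map (digitExpand N)) (x + ((r + N * a : ℕ) : ℝ))‖ ≤
        ‖digitSymbol D ((x + r) / N)‖ * symbolBound N D ^ L := by
      intro r hr
      rw [Finset.mem_range] at hr
      have hr' : (r : ℝ) + 1 ≤ N := by exact_mod_cast hr
      refine le_trans (le_of_eq ?_) (mul_le_mul_of_nonneg_left (ih (x := (x + r) / N) ?_)
        (norm_nonneg _))
      · rw [Finset.mul_sum]
        refine Finset.sum_congr rfl fun a _ => ?_
        have e : (x + ((r + N * a : ℕ) : ℝ)) / N = (x + r) / N + a := by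
          push_cast; field_simp; ring
        rw [fourierMass_digit hN hD, norm_mul, e, digitSymbol_add_nat]
      · exact ⟨div_nonneg (by linarith [hx.1, Nat.cast_nonneg (α := ℝ) r]) hN0.le,
          (div_lt_one hN0).2 (by linarith [hx.2])⟩
    refine (Finset.sum_le_sum hterm).trans ?_
    rw [← Finset.sum_mul]
    refine mul_le_mul_of_nonneg_right (sum_norm_digitSymbol_le hN hD hcard hx) ?_
    have := Real.log_natCast_nonneg N
    unfold symbolBound
    positivity

lemma norm_fourierMass_glueSeq (hN : 2 ≤ N) (hD : ∀ d ∈ D, d < N) (m : ℕ) (ω : ℕ → D) (t : ℝ) :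
    ‖fourierMass ((digitMeasure D).map fun y => digitExpand N (glueSeq m ω y)) t‖ =
      ‖fourierMass ((digitMeasure D).map (digitExpand N)) (t / N ^ m)‖ := by
  have hm : Measurable (digitExpand N : (ℕ → D) → ℝ) := (continuous_digitExpand hN hD).measurable
  obtain ⟨u, hu⟩ := digitExpand_glueSeq hN hD m ω
  unfold fourierMass
  have hg : Measurable fun y => digitExpand N (glueSeq m ω y) := hm.comp (measurable_glueSeq m ω)
  rw [integral_map hg.aemeasurable (by fun_prop),
    integral_map hm.aemeasurable (by fun_prop)]
  have : ∀ y, Complex.exp (((2 * Real.pi * t * digitExpand N (glueSeq m ω y) : ℝ) : ℂ) *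
      Complex.I) = Complex.exp (((2 * Real.pi * t * u : ℝ) : ℂ) * Complex.I) *
      Complex.exp (((2 * Real.pi * (t / N ^ m) * digitExpand N y : ℝ) : ℂ) * Complex.I) := by
    intro y
    rw [hu, ← Complex.exp_add]
    congr 1
    push_cast
    ring
  simp_rw [this]
  rw [integral_const_mul, norm_mul, Complex.norm_exp_ofReal_mul_I, one_mul]

lemma summable_rpow_mul_of_block_bound {N : ℕ} (hN : 2 ≤ N) {B K : ℝ} (hB : 0 ≤ B)
    (hBN : B ^ 24 ≤ N) {m : ℕ} {u : ℕ → ℝ} (hu0 : ∀ n, 0 ≤ u n)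
    (hu : ∀ L, ∑ n ∈ Finset.range (N ^ (m + L)), u n ≤ K * B ^ L) :
    Summable fun n : ℕ => (n : ℝ) ^ (-(1 / 12) : ℝ) * u n := by
  have hN0 : (0 : ℝ) < N := by positivity
  have hN1 : (1 : ℝ) < N := by exact_mod_cast hN
  have hK : 0 ≤ K := by
    have := (Finset.sum_nonneg fun n _ => hu0 n).trans (hu 0)
    simpa using this
  set r : ℝ := (N : ℝ) ^ (-(1 / 24) : ℝ) with hr
  have hr0 : 0 < r := by positivity
  have hr1 : r < 1 := Real.rpow_lt_one_of_one_lt_of_neg hN1 (by norm_num)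
  have hrB : r * B ≤ 1 := by
    refine le_of_pow_le_pow_left₀ (n := 24) (by norm_num) zero_le_one ?_
    rw [mul_pow, hr, ← Real.rpow_natCast, ← Real.rpow_mul hN0.le]
    norm_num
    rw [Real.rpow_neg_one, inv_mul_le_iff₀ hN0, mul_one]
    exact hBN
  have hpow1 : ∀ n : ℕ, (n : ℝ) ^ (-(1 / 12) : ℝ) ≤ 1 := by
    intro n
    rcases Nat.eq_zero_or_pos n with rfl | hn
    · rw [Nat.cast_zero, Real.zero_rpow (by norm_num)]; norm_num
    · exact Real.rpow_le_one_of_one_le_of_nonpos (by exact_mod_cast hn) (by norm_num)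
  have key : ∀ L, ∑ n ∈ Finset.range (N ^ (m + L)), (n : ℝ) ^ (-(1 / 12) : ℝ) * u n ≤
      K * (1 + B * ∑ l ∈ Finset.range L, r ^ l) := by
    intro L
    induction L with
    | zero =>
      simp only [Finset.range_zero, Finset.sum_empty, mul_zero, add_zero]
      calc _ ≤ ∑ n ∈ Finset.range (N ^ m), u n :=
            Finset.sum_le_sum fun n _ => mul_le_of_le_one_left (hu0 n) (hpow1 n)
        _ ≤ _ := by simpa using hu 0
    | succ L ih =>
      have hle : N ^ (m + L) ≤ N ^ (m + (L + 1)) := Nat.pow_le_pow_right (by omega) (by omega)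
      rw [← Finset.sum_range_add_sum_Ico _ hle, Finset.sum_range_succ _ L]
      have hblock : ∑ n ∈ Finset.Ico (N ^ (m + L)) (N ^ (m + (L + 1))),
          (n : ℝ) ^ (-(1 / 12) : ℝ) * u n ≤ K * (B * r ^ L) := by
        calc _ ≤ ∑ n ∈ Finset.Ico (N ^ (m + L)) (N ^ (m + (L + 1))), (r ^ 2) ^ L * u n := by
              refine Finset.sum_le_sum fun n hn => mul_le_mul_of_nonneg_right ?_ (hu0 n)
              rw [Finset.mem_Ico] at hn
              have h1 : (N : ℝ) ^ L ≤ n := by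
                have : N ^ L ≤ n := (Nat.pow_le_pow_right (by omega) (by omega)).trans hn.1
                exact_mod_cast this
              calc (n : ℝ) ^ (-(1 / 12) : ℝ) ≤ ((N : ℝ) ^ L) ^ (-(1 / 12) : ℝ) :=
                    Real.rpow_le_rpow_of_nonpos (by positivity) h1 (by norm_num)
                _ = _ := by
                  rw [hr, ← Real.rpow_natCast, ← Real.rpow_natCast, ← Real.rpow_natCast,
                    ← Real.rpow_mul hN0.le, ← Real.rpow_mul hN0.le, ← Real.rpow_mul hN0.le]
                  congr 1; push_cast; ring
          _ = (r ^ 2) ^ L * ∑ n ∈ Finset.Ico (N ^ (m + L)) (N ^ (m + (L + 1))), u n := by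
              rw [Finset.mul_sum]
          _ ≤ (r ^ 2) ^ L * (K * B ^ (L + 1)) := by
              gcongr
              refine le_trans ?_ (hu (L + 1))
              refine Finset.sum_le_sum_of_subset_of_nonneg (fun n hn => ?_) fun n _ _ => hu0 n
              rw [Finset.mem_Ico] at hn
              exact Finset.mem_range.2 hn.2
          _ = K * (B * (r ^ L * (r * B) ^ L)) := by ring
          _ ≤ _ := by
              gcongr
              exact mul_le_of_le_one_right (by positivity) (pow_le_one₀ (by positivity) hrB)
      calc _ ≤ K * (1 + B * ∑ l ∈ Finset.range L, r ^ l) + K * (B * r ^ L) := add_le_add ih hblock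
        _ = _ := by ring
  refine summable_of_sum_range_le (c := K * (1 + B * (1 - r)⁻¹))
    (fun n => mul_nonneg (by positivity) (hu0 n)) fun n => ?_
  calc _ ≤ ∑ n ∈ Finset.range (N ^ (m + n)), (n : ℝ) ^ (-(1 / 12) : ℝ) * u n := by
        refine Finset.sum_le_sum_of_subset_of_nonneg (Finset.range_subset_range.2 ?_)
          fun k _ _ => mul_nonneg (by positivity) (hu0 k)
        exact (Nat.lt_pow_self (by omega)).le.trans (Nat.pow_le_pow_right (by omega) (by omega))
    _ ≤ _ := key n
    _ ≤ _ := by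
      gcongr
      rw [← tsum_geometric_of_lt_one hr0.le hr1]
      exact (summable_geometric_of_lt_one hr0.le hr1).sum_le_tsum _ fun _ _ => by positivity

lemma summable_fourierMass_glueSeq (hN : 2 ≤ N) (hD : ∀ d ∈ D, d < N) (hcard : N ≤ 2 * D.card)
    (hB : symbolBound N D ^ 24 ≤ N) (m : ℕ) (ω : ℕ → D) :
    Summable fun n : ℕ => (n : ℝ) ^ (-(1 / 12) : ℝ) *
      ‖fourierMass ((digitMeasure D).map fun y => digitExpand N (glueSeq m ω y)) n‖ := by
  have hN0 : (0 : ℝ) < N := by positivity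
  have hB0 : 0 ≤ symbolBound N D := by
    have := Real.log_natCast_nonneg N
    unfold symbolBound
    positivity
  refine summable_rpow_mul_of_block_bound hN (K := (N : ℝ) ^ m) hB0 hB (m := m)
    (fun _ => norm_nonneg _) fun L => ?_
  simp_rw [norm_fourierMass_glueSeq hN hD]
  rw [pow_add, sum_range_mul_eq]
  calc _ ≤ ∑ r ∈ Finset.range (N ^ m), symbolBound N D ^ L := by
        refine Finset.sum_le_sum fun r hr => ?_
        rw [Finset.mem_range] at hr
        have hr' : (r : ℝ) < (N : ℝ) ^ m := by exact_mod_cast hr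
        refine le_trans (le_of_eq ?_) (sum_norm_fourierMass_le hN hD hcard L
          (x := r / (N : ℝ) ^ m) ⟨by positivity, (div_lt_one (by positivity)).2 hr'⟩)
        refine Finset.sum_congr rfl fun a _ => ?_
        congr 2
        push_cast
        field_simp
    _ = _ := by simp

end Decay

section Density

variable {D : Finset ℕ}

/-- The first `m` terms of a sequence. -/
def seqPrefix {α : Type*} (m : ℕ) (y : ℕ → α) : Fin m → α := fun i => y i

lemma measurable_seqPrefix {α : Type*} [MeasurableSpace α] (m : ℕ) :
    Measurable (seqPrefix (α := α) m) :=
  measurable_pi_lambda _ fun _ => measurable_pi_apply _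

lemma cylinder_eq_preimage {α : Type*} (z : ℕ → α) (m : ℕ) :
    PiNat.cylinder z m = seqPrefix m ⁻¹' {seqPrefix m z} := by
  ext y
  simp only [PiNat.mem_cylinder_iff, Set.mem_preimage, Set.mem_singleton_iff, funext_iff, seqPrefix]
  exact ⟨fun h i => h i i.2, fun h i hi => h ⟨i, hi⟩⟩

lemma eq_preimage_of_saturated {α : Type*} {m : ℕ} {C : Set (ℕ → α)}
    (hC : ∀ z ∈ C, PiNat.cylinder z m ⊆ C) :
    C = seqPrefix m ⁻¹'
      (seqPrefix m '' C) := by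
  refine Set.Subset.antisymm (Set.subset_preimage_image _ _) fun y hy => ?_
  obtain ⟨z, hz, hzy⟩ := hy
  refine hC z hz ?_
  rw [cylinder_eq_preimage]
  exact hzy.symm

lemma measurableSet_of_saturated {m : ℕ} {C : Set (ℕ → D)}
    (hC : ∀ z ∈ C, PiNat.cylinder z m ⊆ C) : MeasurableSet C := by
  rw [eq_preimage_of_saturated hC]
  exact measurable_seqPrefix m (Set.toFinite _).measurableSet

lemma mul_measure_le_inter_of_saturated {m : ℕ} {C G : Set (ℕ → D)} (μ : Measure (ℕ → D))
    (hC : ∀ z ∈ C, PiNat.cylinder z m ⊆ C) (κ : ℝ≥0∞)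
    (h : ∀ z ∈ C, κ * μ (PiNat.cylinder z m) ≤ μ (PiNat.cylinder z m ∩ G)) :
    κ * μ C ≤ μ (C ∩ G) := by
  classical
  set T : Finset (Fin m → D) := (Set.toFinite (seqPrefix m '' C)).toFinset with hT
  have hCT : C = seqPrefix m ⁻¹' T := by
    rw [hT, Set.Finite.coe_toFinset]
    exact eq_preimage_of_saturated hC
  have hms : ∀ t ∈ T, MeasurableSet (seqPrefix m ⁻¹' {t}) :=
    fun t _ => measurable_seqPrefix m (measurableSet_singleton t)
  have h1 := sum_measure_preimage_singleton (μ := μ) T hms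
  have h2 := sum_measure_preimage_singleton (μ := μ.restrict G) T hms
  have hCm := measurableSet_of_saturated hC
  rw [← hCT] at h1 h2
  rw [Measure.restrict_apply hCm] at h2
  rw [← h1, ← h2, Finset.mul_sum]
  refine Finset.sum_le_sum fun t ht => ?_
  rw [Measure.restrict_apply (hms t ht)]
  rw [hT, Set.Finite.mem_toFinset] at ht
  obtain ⟨z, hz, rfl⟩ := ht
  simpa only [cylinder_eq_preimage] using h z hz

lemma measure_compl_eq_zero_of_density {G : Set (ℕ → D)} (hG : IsOpen G) (μ : Measure (ℕ → D))
    [IsFiniteMeasure μ] {c : ℝ≥0∞} (hc : c ≠ 0)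
    (h : ∀ ω m, c * μ (PiNat.cylinder ω m) ≤ μ (PiNat.cylinder ω m ∩ G)) : μ Gᶜ = 0 := by
  set C : ℕ → Set (ℕ → D) := fun m => {z | ∃ z' ∈ Gᶜ, z' ∈ PiNat.cylinder z m} with hCdef
  have hsat : ∀ m, ∀ z ∈ C m, PiNat.cylinder z m ⊆ C m := by
    rintro m z ⟨z', hz', hzz'⟩ y hy
    refine ⟨z', hz', ?_⟩
    rwa [PiNat.mem_cylinder_iff_eq.1 hy]
  have hFC : ∀ m, Gᶜ ⊆ C m := fun m z hz => ⟨z, hz, PiNat.self_mem_cylinder z m⟩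
  have hanti : Antitone fun m => C m ∩ G := by
    refine antitone_nat_of_succ_le fun m => ?_
    rintro z ⟨⟨z', hz', hzz'⟩, hzG⟩
    exact ⟨⟨z', hz', PiNat.cylinder_anti z (Nat.le_succ m) hzz'⟩, hzG⟩
  have hempty : ⋂ m, C m ∩ G = ∅ := by
    refine Set.eq_empty_of_forall_notMem fun z hz => ?_
    rw [Set.mem_iInter] at hz
    have hzG := (hz 0).2
    obtain ⟨m, hm⟩ : ∃ m, PiNat.cylinder z m ⊆ G := by
      let _ := PiNat.dist (E := fun _ : ℕ => D)
      obtain ⟨ε, hε, hh⟩ := (PiNat.isOpen_iff_dist G).1 hG z hzG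
      obtain ⟨m, hm⟩ := exists_pow_lt_of_lt_one hε (by norm_num : (1 / 2 : ℝ) < 1)
      refine ⟨m, fun y hy => hh y ?_⟩
      rw [PiNat.dist_comm]
      exact (PiNat.mem_cylinder_iff_dist_le.1 hy).trans_lt hm
    obtain ⟨z', hz', hzz'⟩ := (hz m).1
    exact hz' (hm hzz')
  have hlim : Tendsto (fun m => μ (C m ∩ G)) atTop (nhds 0) := by
    have := tendsto_measure_iInter_atTop (μ := μ) (s := fun m => C m ∩ G)
      (fun m => ((measurableSet_of_saturated (hsat m)).inter hG.measurableSet).nullMeasurableSet)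
      hanti ⟨0, measure_ne_top _ _⟩
    rwa [hempty, measure_empty] at this
  have hle : c * μ Gᶜ ≤ 0 := ge_of_tendsto' hlim fun m =>
    (mul_le_mul_right (measure_mono (hFC m)) c).trans
      (mul_measure_le_inter_of_saturated μ (hsat m) c fun z _ => h z m)
  simpa [hc] using hle

/-- An open set meeting a fixed proportion of cylinders robustly, at arbitrarily deep levels inside
every cylinder, has full measure. -/
lemma measure_compl_eq_zero_of_steering [Nonempty D] {G : Set (ℕ → D)} (hG : IsOpen G) (r : ℕ)
    {c : ℝ≥0∞}
    (hc : c ≠ 0)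
    (h : ∀ ω m, ∃ m' ≥ m, ∃ A, MeasurableSet A ∧ c ≤ digitMeasure D (glueSeq m ω ⁻¹' A) ∧
      ∀ z ∈ A, ∃ z' ∈ PiNat.cylinder z m', PiNat.cylinder z' (m' + r) ⊆ G) :
    digitMeasure D Gᶜ = 0 := by
  have hcard : (D.card : ℝ≥0∞)⁻¹ ≠ 0 := ENNReal.inv_ne_zero.2 (ENNReal.natCast_ne_top _)
  refine measure_compl_eq_zero_of_density hG (digitMeasure D)
    (c := (D.card : ℝ≥0∞)⁻¹ ^ r * c) (mul_ne_zero (pow_ne_zero _ hcard) hc) fun ω m => ?_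
  obtain ⟨m', hm', A, hA, hcA, hsteer⟩ := h ω m
  set C : Set (ℕ → D) := {z | z ∈ PiNat.cylinder ω m ∧
    ∃ z' ∈ PiNat.cylinder z m', PiNat.cylinder z' (m' + r) ⊆ G} with hCdef
  have hsat : ∀ z ∈ C, PiNat.cylinder z m' ⊆ C := by
    rintro z ⟨hz, z', hz', hG'⟩ y hy
    refine ⟨?_, z', ?_, hG'⟩
    · rw [← PiNat.mem_cylinder_iff_eq.1 hz]
      exact PiNat.cylinder_anti z hm' hy
    · rwa [PiNat.mem_cylinder_iff_eq.1 hy]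
  have h1 := mul_measure_le_inter_of_saturated (G := G) (digitMeasure D) hsat
    ((D.card : ℝ≥0∞)⁻¹ ^ r) (by
      rintro z ⟨hz, z', hz', hG'⟩
      rw [digitMeasure_cylinder, ← pow_add, add_comm r m', ← digitMeasure_cylinder D (m' + r) z']
      refine measure_mono fun y hy => ⟨?_, hG' hy⟩
      rw [← PiNat.mem_cylinder_iff_eq.1 hz']
      exact PiNat.cylinder_anti z' (Nat.le_add_right _ _) hy)
  have h2 : (D.card : ℝ≥0∞)⁻¹ ^ m * c ≤ digitMeasure D C := by
    refine le_trans ?_ (measure_mono (fun z hz => ⟨hz.1, hsteer z hz.2⟩ :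
      PiNat.cylinder ω m ∩ A ⊆ C))
    rw [digitMeasure_cylinder_inter D m ω hA]
    gcongr
  calc _ = (D.card : ℝ≥0∞)⁻¹ ^ r * ((D.card : ℝ≥0∞)⁻¹ ^ m * c) := by
        rw [digitMeasure_cylinder]; ring
    _ ≤ (D.card : ℝ≥0∞)⁻¹ ^ r * digitMeasure D C := by gcongr
    _ ≤ digitMeasure D (C ∩ G) := h1
    _ ≤ digitMeasure D (PiNat.cylinder ω m ∩ G) := measure_mono fun z hz => ⟨hz.1.1, hz.2⟩

end Density

lemma digitExpand_sub_eq_of_eq_off {N : ℕ} {D : Finset ℕ} (hN : 2 ≤ N) (hD : ∀ d ∈ D, d < N)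
    {u v : ℕ → D} {i : ℕ} (h : ∀ k ≠ i, u k = v k) :
    digitExpand N u - digitExpand N v = ((u i : ℝ) - (v i : ℝ)) / (N : ℝ) ^ (i + 1) := by
  unfold digitExpand
  rw [← (summable_digitExpand hN hD u).tsum_sub (summable_digitExpand hN hD v),
    tsum_eq_single i fun k hk => by rw [h k hk, sub_self], sub_div]

/-- Short words allow to prescribe a fixed multiple of the digit expansion approximately modulo
one. -/
lemma exists_steering {N : ℕ} {D : Finset ℕ} (hN : 2 ≤ N) (hD : ∀ d ∈ D, d < N) {d₀ d₁ : D}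
    (h01 : (d₀ : ℕ) < d₁) {η : ℝ} (hη : 0 < η) :
    ∃ l > 0, ∃ r : ℕ, ∀ c : ℝ, ∃ u : ℕ → D, ∀ y ∈ PiNat.cylinder u r, ∃ z : ℤ,
      |l * digitExpand N y - c - z| ≤ η := by
  have hN1 : (1 : ℝ) < N := by exact_mod_cast hN
  have hN0 : (0 : ℝ) < N := by linarith
  obtain ⟨b, hb⟩ := pow_unbounded_of_one_lt (2 * N / η + 1) hN1
  have hb0 : 0 < b := by
    rcases Nat.eq_zero_or_pos b with rfl | h
    · have : 0 < 2 * N / η := by positivity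
      simp only [pow_zero] at hb
      linarith
    · exact h
  have hq0 : 0 < (N : ℝ) ^ b - 1 := by
    have : 0 < 2 * N / η := by positivity
    linarith
  have hNq : N / ((N : ℝ) ^ b - 1) ≤ η / 2 := by
    have : 2 * N / η < (N : ℝ) ^ b - 1 := by linarith
    rw [div_lt_iff₀ hη] at this
    rw [div_le_iff₀ hq0]
    linarith
  set M := N ^ b with hM
  set l : ℝ := (N : ℝ) ^ (b * M + 1) / ((N : ℝ) ^ b - 1) with hl
  set Δ : ℝ := (d₁ : ℝ) - (d₀ : ℝ) with hΔ
  have hΔ1 : 1 ≤ Δ := by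
    have : ((d₀ : ℕ) : ℝ) + 1 ≤ (d₁ : ℕ) := by exact_mod_cast h01
    simp only [hΔ]
    linarith
  have hΔN : Δ ≤ N := by
    have h1 : ((d₁ : ℕ) : ℝ) ≤ N := by exact_mod_cast (hD d₁ d₁.2).le
    have h2 : (0 : ℝ) ≤ ((d₀ : ℕ) : ℝ) := Nat.cast_nonneg _
    simp only [hΔ]
    linarith
  set step : ℝ := Δ / ((N : ℝ) ^ b - 1) with hstep
  have hstep0 : 0 < step := by positivity
  have hstepη : step ≤ η / 2 := le_trans (by rw [hstep]; gcongr) hNq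
  set w : ℕ → ℕ → D := fun j k => if b ∣ k ∧ k / b < j then d₁ else d₀ with hw
  have hdiff : ∀ j, digitExpand N (w (j + 1)) - digitExpand N (w j) =
      Δ / (N : ℝ) ^ (b * j + 1) := by
    intro j
    rw [digitExpand_sub_eq_of_eq_off hN hD (i := b * j)]
    · simp [hw, hΔ, Nat.mul_div_cancel_left j hb0]
    · intro k hk
      simp only [hw]
      congr 1
      refine propext (and_congr_right fun hbk => ?_)
      obtain ⟨i, rfl⟩ := hbk
      rw [Nat.mul_div_cancel_left i hb0]
      have : i ≠ j := fun h => hk (by rw [h])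
      omega
  have hmod : ∀ i : ℕ, ∃ z : ℤ, ((N : ℝ) ^ b) ^ i / ((N : ℝ) ^ b - 1) =
      1 / ((N : ℝ) ^ b - 1) + z := by
    intro i
    refine ⟨∑ k ∈ Finset.range i, ((N : ℤ) ^ b) ^ k, ?_⟩
    have := mul_geom_sum ((N : ℝ) ^ b) i
    push_cast
    rw [div_add' _ _ _ hq0.ne']
    congr 1
    linarith
  have hw' : ∀ j ≤ M, ∃ z : ℤ, l * digitExpand N (w j) =
      l * digitExpand N (w 0) + j * step + z := by
    intro j
    induction j with
    | zero => exact fun _ => ⟨0, by simp⟩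
    | succ j ih =>
      intro hj
      obtain ⟨z, hz⟩ := ih (by omega)
      obtain ⟨z', hz'⟩ := hmod (M - j)
      refine ⟨z + (d₁ - d₀) * z', ?_⟩
      have e1 : digitExpand N (w (j + 1)) = digitExpand N (w j) + Δ / (N : ℝ) ^ (b * j + 1) := by
        rw [← hdiff]; ring
      have e2 : l * (Δ / (N : ℝ) ^ (b * j + 1)) =
          Δ * (((N : ℝ) ^ b) ^ (M - j) / ((N : ℝ) ^ b - 1)) := by
        have : (N : ℝ) ^ (b * M + 1) = ((N : ℝ) ^ b) ^ (M - j) * (N : ℝ) ^ (b * j + 1) := by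
          rw [← pow_mul, ← pow_add]
          congr 1
          have : b * (M - j) + b * j = b * M := by rw [← mul_add]; congr 1; omega
          omega
        rw [hl, this]
        field_simp
      rw [e1, mul_add, hz, e2, hz', hstep]
      push_cast
      simp only [hΔ]
      ring
  refine ⟨l, by positivity, b * M + 1, fun c => ?_⟩
  set f := Int.fract (c - l * digitExpand N (w 0)) with hf
  have hf0 : 0 ≤ f := Int.fract_nonneg _
  have hf1 : f < 1 := Int.fract_lt_one _
  set j := ⌊f / step⌋₊ with hj
  have hj1 : (j : ℝ) ≤ f / step := Nat.floor_le (by positivity)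
  have hj2 : f / step < j + 1 := Nat.lt_floor_add_one _
  rw [le_div_iff₀ hstep0] at hj1
  rw [div_lt_iff₀ hstep0] at hj2
  have hjM : j ≤ M := by
    have : (j : ℝ) ≤ M := by
      have h1 : (j : ℝ) * step ≤ 1 := by linarith
      rw [hstep, mul_div_assoc', div_le_one hq0] at h1
      rw [hM]
      push_cast
      nlinarith [Nat.cast_nonneg (α := ℝ) j]
    exact_mod_cast this
  obtain ⟨z, hz⟩ := hw' j hjM
  refine ⟨w j, fun y hy => ⟨z - ⌊c - l * digitExpand N (w 0)⌋, ?_⟩⟩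
  have hfl : f = c - l * digitExpand N (w 0) - ⌊c - l * digitExpand N (w 0)⌋ := rfl
  have hyu := abs_digitExpand_sub_le hN hD hy
  have hl1 : l * (1 / (N : ℝ) ^ (b * M + 1)) ≤ η / 2 := by
    refine le_trans (le_of_eq ?_) (le_trans (?_ : 1 / ((N : ℝ) ^ b - 1) ≤ _) hNq)
    · rw [hl]; field_simp
    · gcongr
  have hl0 : 0 < l := by positivity
  have h3 : |l * (digitExpand N (w j) - digitExpand N y)| ≤ η / 2 := by
    rw [abs_mul, abs_of_pos hl0]
    exact (mul_le_mul_of_nonneg_left hyu hl0.le).trans hl1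
  rw [abs_le] at h3 ⊢
  push_cast
  constructor <;> linarith [h3.1, h3.2]

lemma exists_isCoprime_near_kernel {x y z w : ℝ} (hdet : x * w - y * z = 1) {δ : ℝ} (hδ : 0 < δ) :
    ∃ m n : ℤ, IsCoprime m n ∧ 0 < x * m + y * n ∧ |z * m + w * n| ≤ δ * (x * m + y * n) := by
  obtain ⟨m, n, hmn, h0, h⟩ : ∃ m n : ℤ, IsCoprime m n ∧ x * m + y * n ≠ 0 ∧
      |z * m + w * n| ≤ δ * |x * m + y * n| := by
    by_cases hw : w = 0
    · refine ⟨0, 1, isCoprime_one_right, ?_, ?_⟩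
      · rintro h
        simp only [Int.cast_zero, Int.cast_one, mul_zero, mul_one, zero_add] at h
        simp [hw, h] at hdet
      · simp only [hw, Int.cast_zero, Int.cast_one, mul_zero, zero_mul, add_zero, abs_zero]
        positivity
    · have hopen : IsOpen {t : ℝ | |z + w * t| < δ * |x + y * t|} :=
        isOpen_lt (by fun_prop) (by fun_prop)
      have hmem : (-z / w) ∈ {t : ℝ | |z + w * t| < δ * |x + y * t|} := by
        have e1 : z + w * (-z / w) = 0 := by field_simp; ring
        have e2 : x + y * (-z / w) = 1 / w := by field_simp; linarith
        rw [Set.mem_ofPred_eq, e1, e2, abs_zero]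
        positivity
      obtain ⟨t, ht⟩ := Rat.isDenseEmbedding_coe_real.dense.exists_mem_open hopen ⟨_, hmem⟩
      have hden : (0 : ℝ) < t.den := by exact_mod_cast t.den_pos
      have ht' : (t : ℝ) * t.den = t.num := by exact_mod_cast Rat.mul_den_eq_num t
      have e1 : z * ((t.den : ℤ) : ℝ) + w * (t.num : ℝ) = t.den * (z + w * t) := by
        rw [← ht']; push_cast; ring
      have e2 : x * ((t.den : ℤ) : ℝ) + y * (t.num : ℝ) = t.den * (x + y * t) := by
        rw [← ht']; push_cast; ring
      rw [Set.mem_ofPred_eq] at ht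
      refine ⟨t.den, t.num, ?_, ?_, ?_⟩
      · rw [Int.isCoprime_iff_gcd_eq_one, Int.gcd_comm]
        exact t.reduced
      · rw [e2]
        refine mul_ne_zero hden.ne' fun h => ?_
        rw [h, abs_zero, mul_zero] at ht
        exact absurd (abs_nonneg (z + w * t)) (not_le.2 ht)
      · rw [e1, e2, abs_mul, abs_mul, abs_of_pos hden]
        nlinarith
  rcases h0.lt_or_gt with hneg | hpos
  · refine ⟨-m, -n, hmn.neg_neg, ?_, ?_⟩
    · push_cast; linarith
    · rw [abs_of_neg hneg] at h
      have : z * ((-m : ℤ) : ℝ) + w * ((-n : ℤ) : ℝ) = -(z * m + w * n) := by push_cast; ring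
      rw [this, abs_neg]
      push_cast
      linarith
  · rw [abs_of_pos hpos] at h
    exact ⟨m, n, hmn, hpos, h⟩

lemma exists_int_column {x y z w : ℝ} (hdet : x * w - y * z = 1) {δ : ℝ} (hδ : 0 < δ)
    (hδ1 : δ ≤ 1 / 2) :
    ∃ A > 0, ∀ a ≥ A, ∃ p q r s : ℤ, p * s - q * r = 1 ∧ |x * p + y * r - a| ≤ δ * a ∧
      |z * p + w * r| ≤ δ * (x * p + y * r) := by
  obtain ⟨m₀, n₀, ⟨u, v, huv⟩, hX₀, hZ₀⟩ := exists_isCoprime_near_kernel hdet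
    (by positivity : 0 < δ / 4)
  set X₀ := x * m₀ + y * n₀ with hX₀'
  set Z₀ := z * m₀ + w * n₀ with hZ₀'
  set X₁ := x * v - y * u with hX₁
  set Z₁ := z * v - w * u with hZ₁
  refine ⟨8 * (|Z₁| + X₀ + |X₁|) / δ, by positivity, fun a ha => ?_⟩
  have hZ1 := abs_nonneg Z₁
  have hX1 := abs_nonneg X₁
  have ha8 : 8 * (|Z₁| + X₀ + |X₁|) ≤ δ * a := by
    rw [ge_iff_le, div_le_iff₀ hδ] at ha
    linarith
  have ha0 : 0 < a := by
    by_contra h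
    nlinarith
  set l := ⌊(a - X₁) / X₀⌋ with hl
  have hl1 : (l : ℝ) * X₀ ≤ a - X₁ := by
    rw [← le_div_iff₀ hX₀]; exact Int.floor_le _
  have hl2 : a - X₁ < (l + 1) * X₀ := by
    rw [← div_lt_iff₀ hX₀]; exact Int.lt_floor_add_one _
  refine ⟨v + l * m₀, m₀, -u + l * n₀, n₀, by linear_combination huv, ?_, ?_⟩
  all_goals
    have eX : x * ((v + l * m₀ : ℤ) : ℝ) + y * ((-u + l * n₀ : ℤ) : ℝ) = X₁ + l * X₀ := by
      push_cast; simp only [hX₁, hX₀']; ring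
    have eZ : z * ((v + l * m₀ : ℤ) : ℝ) + w * ((-u + l * n₀ : ℤ) : ℝ) = Z₁ + l * Z₀ := by
      push_cast; simp only [hZ₁, hZ₀']; ring
  · rw [eX, abs_le]
    constructor <;> nlinarith
  · rw [eX, eZ]
    have hlX : |(l : ℝ)| * X₀ ≤ a + X₀ + |X₁| := by
      rw [← abs_of_pos hX₀, ← abs_mul, abs_of_pos hX₀, abs_le]
      constructor <;> nlinarith [le_abs_self X₁, neg_abs_le X₁]
    have h1 : |(l : ℝ) * Z₀| ≤ δ / 4 * (a + X₀ + |X₁|) := by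
      rw [abs_mul]
      calc |(l : ℝ)| * |Z₀| ≤ |(l : ℝ)| * (δ / 4 * X₀) := by gcongr
        _ = δ / 4 * (|(l : ℝ)| * X₀) := by ring
        _ ≤ _ := by gcongr
    have h2 : a / 2 ≤ X₁ + l * X₀ := by nlinarith
    have h3 := abs_add_le Z₁ (l * Z₀)
    nlinarith

lemma exists_near_one_mul_mem {V : Set SL2R} (hV : IsOpen V) {M₀ : SL2R} (hM₀ : M₀ ∈ V) :
    ∃ ε > 0, ∀ P : SL2R, (∀ i j, |P i j - (1 : Matrix (Fin 2) (Fin 2) ℝ) i j| ≤ ε) →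
      P * M₀ ∈ V := by
  obtain ⟨W, hW, rfl⟩ := isOpen_induced_iff.1 hV
  have hc : Continuous fun P : Fin 2 → Fin 2 → ℝ =>
      (Matrix.of P * (M₀ : Matrix (Fin 2) (Fin 2) ℝ) : Matrix (Fin 2) (Fin 2) ℝ) := by
    refine continuous_matrix fun i j => ?_
    simp only [Matrix.mul_apply, Matrix.of_apply]
    fun_prop
  have hmem : (fun i j => (1 : Matrix (Fin 2) (Fin 2) ℝ) i j) ∈ (fun P : Fin 2 → Fin 2 → ℝ =>
      (Matrix.of P * (M₀ : Matrix (Fin 2) (Fin 2) ℝ) : Matrix (Fin 2) (Fin 2) ℝ)) ⁻¹' W := by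
    change (1 : Matrix (Fin 2) (Fin 2) ℝ) * (M₀ : Matrix (Fin 2) (Fin 2) ℝ) ∈ W
    rw [one_mul]
    exact hM₀
  obtain ⟨ε, hε, h⟩ := Metric.isOpen_iff.1 (hW.preimage hc) _ hmem
  refine ⟨ε / 2, by positivity, fun P hP => ?_⟩
  have hPmem : (fun i j => P i j) ∈ Metric.ball
      (fun i j => (1 : Matrix (Fin 2) (Fin 2) ℝ) i j) ε := by
    rw [Metric.mem_ball, dist_pi_lt_iff hε]
    intro i
    rw [dist_pi_lt_iff hε]
    intro j
    rw [Real.dist_eq]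
    exact (hP i j).trans_lt (by linarith)
  exact h hPmem

lemma abs_mul_inv_sub_one_le {δ a' ρ φ : ℝ} (hδ0 : 0 < δ) (hδ1 : δ ≤ 1 / 10) {M K : SL2R}
    (ha' : 0 < a') (hX0 : 0 < K 0 0) (h00 : M 0 0 = a') (h01 : M 0 1 = a' * φ)
    (h10 : M 1 0 = ρ * a') (hρ1 : |ρ| ≤ δ) (ht1 : |a' / K 0 0 - 1| ≤ δ)
    (hσ1 : |K 1 0 / K 0 0| ≤ δ) (hb1 : |a' * K 0 0 * (φ - K 0 1 / K 0 0)| ≤ δ) (i j : Fin 2) :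
    |(M * K⁻¹ : SL2R) i j - (1 : Matrix (Fin 2) (Fin 2) ℝ) i j| ≤ 10 * δ := by
  have hXW : K 0 0 * K 1 1 - K 0 1 * K 1 0 = 1 := by
    have := K.det_coe
    rwa [Matrix.det_fin_two] at this
  have hdetM : a' * M 1 1 - a' * φ * (ρ * a') = 1 := by
    have := M.det_coe
    rwa [Matrix.det_fin_two, h00, h01, h10] at this
  have hP : (M * K⁻¹ : SL2R) i j =
      (M.1 * !![K 1 1, -K 0 1; -K 1 0, K 0 0] : Matrix (Fin 2) (Fin 2) ℝ) i j := by
    rw [Matrix.SpecialLinearGroup.coe_mul, Matrix.SpecialLinearGroup.coe_inv,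
      Matrix.adjugate_fin_two]
  rw [hP]
  clear hP
  generalize K 0 0 = X at *
  generalize K 0 1 = Y at *
  generalize K 1 0 = Z at *
  generalize K 1 1 = W at *
  have hM11 : M 1 1 = ρ * a' * φ + 1 / a' := by
    field_simp
    linarith
  have hW : W = Y / X * Z + 1 / X := by
    field_simp
    linarith
  set t := a' / X with ht
  set σ := Z / X with hσ
  set b := a' * X * (φ - Y / X) with hb
  have ht0 : 0 < t := div_pos ha' hX0
  have hP00 : a' * W + a' * φ * -Z = t - b * σ := by
    rw [hW, ht, hb, hσ]
    field_simp
    ring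
  have hP01 : a' * -Y + a' * φ * X = b := by
    rw [hb]
    field_simp
    ring
  have hP10 : ρ * a' * W + (ρ * a' * φ + 1 / a') * -Z = ρ * t - ρ * b * σ - σ * (1 / t) := by
    rw [hW, ht, hb, hσ]
    field_simp
    ring
  have hP11 : ρ * a' * -Y + (ρ * a' * φ + 1 / a') * X = ρ * b + 1 / t := by
    rw [ht, hb]
    field_simp
    ring
  have htinv : |1 / t - 1| ≤ 2 * δ := by
    have : 1 / t - 1 = -(t - 1) / t := by field_simp; ring
    rw [this, abs_div, abs_neg, abs_of_pos ht0, div_le_iff₀ ht0]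
    nlinarith [(abs_le.1 ht1).1]
  have ht2 : t ≤ 2 := by linarith [(abs_le.1 ht1).2]
  have htinv2 : 1 / t ≤ 2 := by linarith [(abs_le.1 htinv).2]
  have hδ2 : δ ≤ 1 := by linarith
  have hbσ : |b * σ| ≤ δ * 1 := by
    rw [abs_mul]; exact mul_le_mul hb1 (hσ1.trans hδ2) (abs_nonneg _) hδ0.le
  have hρb : |ρ * b| ≤ δ * 1 := by
    rw [abs_mul]; exact mul_le_mul hρ1 (hb1.trans hδ2) (abs_nonneg _) hδ0.le
  have hρbσ : |ρ * b * σ| ≤ δ * 1 * 1 := by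
    rw [abs_mul]; exact mul_le_mul hρb (hσ1.trans hδ2) (abs_nonneg _) (by positivity)
  have hρt : |ρ * t| ≤ δ * 2 := by
    rw [abs_mul, abs_of_pos ht0]; exact mul_le_mul hρ1 ht2 ht0.le hδ0.le
  have hσt : |σ * (1 / t)| ≤ δ * 2 := by
    have : 0 < 1 / t := by positivity
    rw [abs_mul, abs_of_pos this]; exact mul_le_mul hσ1 htinv2 this.le hδ0.le
  rw [abs_le] at ht1 htinv hb1 hbσ hρb hρbσ hρt hσt
  fin_cases i <;> fin_cases j <;>
    simp only [Fin.zero_eta, Fin.mk_one, Matrix.one_apply_eq, ne_eq, zero_ne_one, one_ne_zero,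
      not_false_eq_true, Matrix.one_apply_ne, Matrix.mul_apply, Fin.sum_univ_two,
      Matrix.of_apply, Matrix.cons_val', Matrix.cons_val_zero, Matrix.cons_val_one,
      Matrix.cons_val_fin_one, h00, h01, h10, hM11, hP00, hP01, hP10, hP11] <;>
    rw [abs_le] <;> constructor <;> linarith

/-- Matrices `[[a, aφ], [ρa, *]]` with `ρ` small and `φ` in a suitable window depending on `a` can
be moved into a prescribed open set by an integer matrix. -/
lemma exists_window {V : Set SL2R} (hV : IsOpen V) (hne : V.Nonempty) {L : ℝ} (hL : 1 ≤ L) :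
    ∃ A > 0, ∃ η > 0, ∀ a ∈ Set.Icc A (L * A), ∃ φ₀ : ℝ, ∀ a' ρ φ : ℝ,
      |a' - a| ≤ η * a → |ρ| ≤ η → |φ - φ₀| ≤ η → ∀ M : SL2R, M 0 0 = a' → M 0 1 = a' * φ →
      M 1 0 = ρ * a' → ∃ γ ∈ SL2Zsub, M * γ ∈ V := by
  obtain ⟨M₀, hM₀⟩ := hne
  obtain ⟨ε, hε, hεV⟩ := exists_near_one_mul_mem hV hM₀
  set δ : ℝ := min (ε / 10) (1 / 10) with hδ
  have hδ0 : 0 < δ := by positivity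
  have hδε : δ ≤ ε / 10 := min_le_left _ _
  have hδ1 : δ ≤ 1 / 10 := min_le_right _ _
  have hdet0 : M₀ 0 0 * M₀ 1 1 - M₀ 0 1 * M₀ 1 0 = 1 := by
    have := M₀.det_coe
    rwa [Matrix.det_fin_two] at this
  obtain ⟨A, hA, hcol⟩ := exists_int_column hdet0 (by positivity : 0 < δ / 4) (by linarith)
  have hLA : 0 < L * A := by positivity
  refine ⟨A, hA, min (δ / 4) (δ / (4 * (L * A) ^ 2)), by positivity, fun a ha => ?_⟩
  obtain ⟨p, q, r, s, hps, hX, hZ⟩ := hcol a ha.1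
  have ha0 : 0 < a := hA.trans_le ha.1
  set X : ℝ := M₀ 0 0 * p + M₀ 0 1 * r with hXdef
  set Z : ℝ := M₀ 1 0 * p + M₀ 1 1 * r with hZdef
  set Y : ℝ := M₀ 0 0 * q + M₀ 0 1 * s with hYdef
  set W : ℝ := M₀ 1 0 * q + M₀ 1 1 * s with hWdef
  have hpsR : (p : ℝ) * s - q * r = 1 := by exact_mod_cast hps
  have hXW : X * W - Y * Z = 1 := by
    have : X * W - Y * Z = (M₀ 0 0 * M₀ 1 1 - M₀ 0 1 * M₀ 1 0) * (p * s - q * r) := by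
      simp only [hXdef, hZdef, hYdef, hWdef]; ring
    rw [this, hdet0, hpsR, one_mul]
  set γ' : SL2Z := ⟨!![p, q; r, s], by rw [Matrix.det_fin_two_of]; exact hps⟩ with hγ'
  set Γ : SL2R := Matrix.SpecialLinearGroup.map (n := Fin 2) (Int.castRingHom ℝ) γ' with hΓ
  set K : SL2R := M₀ * Γ with hK
  have hΓe : ∀ i j, Γ i j = ((γ' i j : ℤ) : ℝ) := fun i j => rfl
  have hK00 : K 0 0 = X := by
    simp [hK, hΓe, hγ', Matrix.mul_apply, Fin.sum_univ_two, hXdef]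
  have hK01 : K 0 1 = Y := by
    simp [hK, hΓe, hγ', Matrix.mul_apply, Fin.sum_univ_two, hYdef]
  have hK10 : K 1 0 = Z := by
    simp [hK, hΓe, hγ', Matrix.mul_apply, Fin.sum_univ_two, hZdef]
  have hK11 : K 1 1 = W := by
    simp [hK, hΓe, hγ', Matrix.mul_apply, Fin.sum_univ_two, hWdef]
  have hX' := abs_le.1 hX
  have hδa : δ * a ≤ 1 / 10 * a := by gcongr
  have hXa : a / 2 ≤ X := by linarith
  have hXa' : X ≤ 2 * a := by linarith
  have hX0 : 0 < X := by linarith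
  have hδX : δ * (a / 2) ≤ δ * X := by gcongr
  refine ⟨Y / X, fun a' ρ φ ha' hρ hφ M h00 h01 h10 => ?_⟩
  refine ⟨Γ⁻¹, inv_mem ⟨γ', rfl⟩, ?_⟩
  have hMK : M * Γ⁻¹ = M * K⁻¹ * M₀ := by rw [hK]; group
  rw [hMK]
  have hη1 : min (δ / 4) (δ / (4 * (L * A) ^ 2)) ≤ δ / 4 := min_le_left _ _
  have hη2 : min (δ / 4) (δ / (4 * (L * A) ^ 2)) ≤ δ / (4 * (L * A) ^ 2) := min_le_right _ _
  have ha1 : |a' - a| ≤ δ / 4 * a := ha'.trans (by gcongr)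
  have ha1' := abs_le.1 ha1
  have ha'0 : 0 < a' := by linarith
  have hρ1 : |ρ| ≤ δ := by linarith
  have ht1 : |a' / X - 1| ≤ δ := by
    have : a' / X - 1 = (a' - X) / X := by field_simp
    rw [this, abs_div, abs_of_pos hX0, div_le_iff₀ hX0, abs_le]
    constructor <;> linarith
  have hσ1 : |Z / X| ≤ δ := by
    rw [abs_div, abs_of_pos hX0, div_le_iff₀ hX0]
    linarith [mul_pos hδ0 hX0]
  have hb1 : |a' * X * (φ - Y / X)| ≤ δ := by
    have h1 : a' * X ≤ 4 * (L * A) ^ 2 := by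
      have h2 : a' ≤ 2 * (L * A) := by linarith [ha.2]
      have h3 : X ≤ 2 * (L * A) := by linarith [ha.2]
      calc a' * X ≤ 2 * (L * A) * (2 * (L * A)) := by gcongr
        _ = _ := by ring
    have h2 : |φ - Y / X| ≤ δ / (4 * (L * A) ^ 2) := hφ.trans hη2
    rw [abs_mul, abs_of_pos (mul_pos ha'0 hX0)]
    calc a' * X * |φ - Y / X| ≤ 4 * (L * A) ^ 2 * (δ / (4 * (L * A) ^ 2)) := by gcongr
      _ = δ := by field_simp
  refine hεV _ fun i j => (abs_mul_inv_sub_one_le hδ0 hδ1 ha'0 ?_ h00 h01 h10 hρ1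
    ?_ ?_ ?_ i j).trans
    (by linarith)
  · rwa [hK00]
  · rwa [hK00]
  · rwa [hK00, hK10]
  · rwa [hK00, hK01]

/-- The upper unipotent matrix `[[1, s], [0, 1]]`. -/
def upperMat (s : ℝ) : SL2R := ⟨!![(1 : ℝ), s; 0, 1], by simp [Matrix.det_fin_two_of]⟩

lemma coe_upperMat (s : ℝ) : (upperMat s : Matrix (Fin 2) (Fin 2) ℝ) = !![1, s; 0, 1] := rfl

lemma coe_g2 (t : ℝ) :
    (g2 t : Matrix (Fin 2) (Fin 2) ℝ) = !![Real.exp t, 0; 0, Real.exp (-t)] := rfl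

lemma g2_pow (t : ℝ) (k : ℕ) : g2 t ^ k = g2 (t * k) := by
  induction k with
  | zero =>
    ext i j
    fin_cases i <;> fin_cases j <;> simp [coe_g2]
  | succ k ih =>
    rw [pow_succ, ih]
    ext i j
    fin_cases i <;> fin_cases j <;>
      simp [coe_g2, ← Real.exp_add] <;> ring_nf

/-- Coordinates of a diagonal translate of `h(s)`, seen from the rational `p / q`. -/
lemma exists_diag_coords {p q : ℤ} (hpq : IsCoprime p q) (hq : 0 < q) :
    ∃ β : ℝ, ∀ (t s : ℝ) (z : ℤ), s ≠ p / q → ∃ Γ ∈ SL2Zsub,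
      (g2 t * upperMat s * Γ) 0 0 = Real.exp t * (q * (s - p / q)) ∧
      (g2 t * upperMat s * Γ) 0 1 = Real.exp t * (q * (s - p / q)) *
        (β - 1 / (q ^ 2 * (s - p / q)) + z) ∧
      (g2 t * upperMat s * Γ) 1 0 = Real.exp (-t) * q := by
  obtain ⟨u, v, huv⟩ := hpq
  have hqR : (0 : ℝ) < q := by exact_mod_cast hq
  have huvR : (u : ℝ) * p + v * q = 1 := by exact_mod_cast huv
  refine ⟨-u / q, fun t s z hs => ?_⟩
  set γ : SL2Z := ⟨!![-p, -(v + z * p); q, -u + z * q], by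
    rw [Matrix.det_fin_two_of]; linear_combination huv⟩ with hγ
  set Γ : SL2R := Matrix.SpecialLinearGroup.map (n := Fin 2) (Int.castRingHom ℝ) γ with hΓ
  have hΓe : ∀ i j, Γ i j = ((γ i j : ℤ) : ℝ) := fun i j => rfl
  have hs' : s - p / q ≠ 0 := sub_ne_zero.2 hs
  have hs'' : s * q - p ≠ 0 := by
    intro h
    apply hs'
    field_simp
    linarith
  refine ⟨Γ, ⟨γ, rfl⟩, ?_, ?_, ?_⟩
  · simp [coe_g2, coe_upperMat, Matrix.mul_apply, Fin.sum_univ_two, hΓe, hγ]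
    field_simp
    ring
  · simp [coe_g2, coe_upperMat, Matrix.mul_apply, Fin.sum_univ_two, hΓe, hγ]
    field_simp
    linear_combination -huvR
  · simp [coe_g2, coe_upperMat, Matrix.mul_apply, Fin.sum_univ_two, hΓe, hγ]

lemma abs_mul_sub_one_le {τ x y : ℝ} (hτ : 0 ≤ τ) (hτ1 : τ ≤ 1 / 20) (hx : x ∈ Set.Icc 1 (1 + τ))
    (hy : |y - 1| ≤ 2 * τ) : |x * y - 1| ≤ 4 * τ := by
  rw [abs_le] at hy ⊢
  obtain ⟨h1, h2⟩ := hx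
  constructor <;> nlinarith

lemma abs_inv_mul_sub_one_le {τ x y z : ℝ} (hτ : 0 ≤ τ) (hτ1 : τ ≤ 1 / 20)
    (hx : x ∈ Set.Icc 1 (1 + τ)) (hy : |y - 1| ≤ 2 * τ) (hz : |z - 1| ≤ 2 * τ) :
    |1 / (x ^ 2 * y * z) - 1| ≤ 20 * τ := by
  have h1 := abs_le.1 (abs_mul_sub_one_le hτ hτ1 hx hy)
  have h2 := abs_le.1 (abs_mul_sub_one_le hτ hτ1 hx hz)
  set a := x * y
  set b := x * z
  have hab : x ^ 2 * y * z = a * b := by ring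
  have ha : 4 / 5 ≤ a := by linarith
  have hb : 4 / 5 ≤ b := by linarith
  have hab1 : a * b - 1 = (a - 1) * b + (b - 1) := by ring
  have hab2 : 16 / 25 ≤ a * b := by nlinarith
  have hab3 : |a * b - 1| ≤ 9 * τ := by
    rw [hab1, abs_le]
    constructor <;> nlinarith
  have hab0 : 0 < a * b := by linarith
  have : 1 / (a * b) - 1 = -(a * b - 1) / (a * b) := by field_simp; ring
  rw [hab, this, abs_div, abs_neg, abs_of_pos hab0, div_le_iff₀ hab0]
  nlinarith

lemma exists_nat_exp_mul_mem_Icc {t A x : ℝ} (ht : 0 < t) (hx : 0 < x) (hxA : x ≤ A) :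
    ∃ k : ℕ, Real.exp (t * k) * x ∈ Set.Icc A (Real.exp t * A) := by
  have hA : 0 < A := hx.trans_le hxA
  have h1 : 1 ≤ A / x := (one_le_div hx).2 hxA
  have hlog : 0 ≤ Real.log (A / x) := Real.log_nonneg h1
  refine ⟨⌈Real.log (A / x) / t⌉₊, ?_⟩
  set k := ⌈Real.log (A / x) / t⌉₊
  have hk1 : Real.log (A / x) ≤ t * k := by
    have := Nat.le_ceil (Real.log (A / x) / t)
    rw [div_le_iff₀ ht] at this
    linarith
  have hk2 : t * k ≤ Real.log (A / x) + t := by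
    have := (Nat.ceil_lt_add_one (by positivity : 0 ≤ Real.log (A / x) / t)).le
    have h2 : (k : ℝ) * t ≤ (Real.log (A / x) / t + 1) * t := by gcongr
    rw [add_mul, div_mul_cancel₀ _ ht.ne', one_mul] at h2
    linarith
  have e : Real.exp (Real.log (A / x)) = A / x := Real.exp_log (by positivity)
  constructor
  · have := Real.exp_le_exp.2 hk1
    rw [e, div_le_iff₀ hx] at this
    exact this
  · have := Real.exp_le_exp.2 hk2
    rw [Real.exp_add, e] at this
    calc _ ≤ A / x * Real.exp t * x := by gcongr
      _ = _ := by field_simp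

/-- Points whose digit expansion is suitably close to a rational number at some scale can be
steered, by prescribing boundedly many further digits, into a given open set along the orbit. -/
lemma exists_steered_cylinder {V : Set SL2R} (hV : IsOpen V) (hne : V.Nonempty) {t₀ : ℝ}
    (ht₀ : 0 < t₀) {N : ℕ} {D : Finset ℕ} (hN : 2 ≤ N) (hD : ∀ d ∈ D, d < N) {d₀ d₁ : D}
    (h01 : (d₀ : ℕ) < d₁) :
    ∃ τ > 0, τ ≤ 1 / 20 ∧ ∃ R₀ ≥ 1, ∃ l > 0, ∃ r : ℕ, ∃ Q₁ > 0, ∀ (m : ℕ) (Q : ℝ), Q₁ ≤ Q →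
      R₀ ^ 2 * Q ^ 2 = l * (N : ℝ) ^ m → ∀ z : ℕ → D,
      ReducedApprox ⌊Q⌋₊ ⌊(1 + τ) * Q⌋₊ (1 / (R₀ * Q ^ 2)) (τ / (R₀ * Q ^ 2)) (digitExpand N z) →
      ∃ z' ∈ PiNat.cylinder z m, ∀ y ∈ PiNat.cylinder z' (m + r), ∃ k : ℕ, ∃ γ ∈ SL2Zsub,
        g2 t₀ ^ k * upperMat (digitExpand N y) * γ ∈ V := by
  obtain ⟨A, hA, η, hη, hwin⟩ := exists_window hV hne (Real.one_le_exp ht₀.le)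
  obtain ⟨l, hl, r, hsteer⟩ := exists_steering hN hD h01 (half_pos hη)
  set τ : ℝ := min (1 / 20) (min (η / (40 * l)) (η / 4)) with hτ
  have hτ0 : 0 < τ := by positivity
  have hτ1 : τ ≤ 1 / 20 := min_le_left _ _
  have hτ2 : 20 * τ * l ≤ η / 2 := by
    have : τ ≤ η / (40 * l) := (min_le_right _ _).trans (min_le_left _ _)
    rw [le_div_iff₀ (by positivity)] at this
    linarith
  have hτ3 : 4 * τ ≤ η := by
    have : τ ≤ η / 4 := (min_le_right _ _).trans (min_le_right _ _)
    linarith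
  set R₀ : ℝ := max 1 (max (l / τ) (2 / (A ^ 2 * η))) with hR₀
  have hR1 : 1 ≤ R₀ := le_max_left _ _
  have hR0 : 0 < R₀ := by linarith
  have hR2 : l ≤ τ * R₀ := by
    have : l / τ ≤ R₀ := (le_max_left _ _).trans (le_max_right _ _)
    rw [div_le_iff₀ hτ0] at this
    linarith
  have hR3 : 2 ≤ R₀ * (A ^ 2 * η) := by
    have : 2 / (A ^ 2 * η) ≤ R₀ := (le_max_right _ _).trans (le_max_right _ _)
    rwa [div_le_iff₀ (by positivity)] at this
  refine ⟨τ, hτ0, hτ1, R₀, hR1, l, hl, r, 1 / (R₀ * A), by positivity, ?_⟩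
  rintro m Q hQ1 hQ z ⟨q, hq, p, hpq, hzp⟩
  have hQ0 : 0 < Q := lt_of_lt_of_le (by positivity) hQ1
  rw [Finset.mem_Ioc] at hq
  have hqQ : Q < q := (Nat.floor_lt hQ0.le).1 hq.1
  have hqQ' : (q : ℝ) ≤ (1 + τ) * Q :=
    (Nat.cast_le.2 hq.2).trans (Nat.floor_le (by positivity))
  have hq0 : (0 : ℝ) < q := hQ0.trans hqQ
  have hqZ : (0 : ℤ) < (q : ℤ) := by exact_mod_cast hq0
  set x₀ : ℝ := 1 / (R₀ * Q ^ 2) with hx₀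
  have hx₀0 : 0 < x₀ := by positivity
  have hτx : τ / (R₀ * Q ^ 2) = τ * x₀ := by rw [hx₀]; ring
  rw [hτx] at hzp
  set P : ℝ := (N : ℝ) ^ m with hP
  have hP0 : 0 < P := by positivity
  have hPx : 1 / P ≤ τ * x₀ := by
    rw [hx₀, mul_one_div, div_le_div_iff₀ hP0 (by positivity)]
    have : l * (1 * (R₀ * Q ^ 2)) ≤ τ * R₀ * (R₀ * Q ^ 2) := by
      rw [one_mul]; gcongr
    have h2 : τ * R₀ * (R₀ * Q ^ 2) = τ * (l * P) := by rw [← hQ]; ring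
    rw [h2] at this
    have h3 : l * (1 * (R₀ * Q ^ 2)) ≤ l * (τ * P) := by linarith
    exact le_of_mul_le_mul_left h3 hl
  obtain ⟨U, hU⟩ := digitExpand_glueSeq hN hD m z
  set δ : ℝ → ℝ := fun v => U + v / P - p / q with hδ
  have hδx : ∀ v ∈ Set.Icc (0 : ℝ) 1, |δ v / x₀ - 1| ≤ 2 * τ := by
    intro v hv
    have hz := hU fun k => z (k + m)
    rw [glueSeq_eq_of_mem_cylinder (PiNat.self_mem_cylinder z m)] at hz
    set vz := digitExpand N fun k => z (k + m)
    have hvz0 : 0 ≤ vz := digitExpand_nonneg _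
    have hvz1 : vz ≤ 1 := digitExpand_le_one hN hD _
    have e : δ v - x₀ = (digitExpand N z - x₀ - p / q) + (v - vz) * (1 / P) := by
      rw [hz]; simp only [hδ]; ring
    have h1 : |(v - vz) * (1 / P)| ≤ 1 * (τ * x₀) := by
      rw [abs_mul, abs_of_pos (by positivity : 0 < 1 / P)]
      refine mul_le_mul ?_ hPx (by positivity) zero_le_one
      rw [abs_le]; constructor <;> linarith [hv.1, hv.2]
    have h2 := abs_add_le (digitExpand N z - x₀ - p / q) ((v - vz) * (1 / P))
    have e2 : δ v / x₀ - 1 = (δ v - x₀) / x₀ := by field_simp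
    rw [e2, abs_div, abs_of_pos hx₀0, div_le_iff₀ hx₀0, e]
    linarith
  have hκ : q / Q ∈ Set.Icc 1 (1 + τ) := ⟨(one_le_div hQ0).2 hqQ.le, (div_le_iff₀ hQ0).2 hqQ'⟩
  obtain ⟨β, hβ⟩ := exists_diag_coords hpq hqZ
  have hQx : Q * x₀ ≤ A := by
    have : Q * x₀ = 1 / (R₀ * Q) := by rw [hx₀]; field_simp
    rw [this, div_le_iff₀ (by positivity)]
    rw [div_le_iff₀ (by positivity)] at hQ1
    linarith
  obtain ⟨k, hk⟩ := exists_nat_exp_mul_mem_Icc ht₀ (mul_pos hQ0 hx₀0) hQx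
  set E := Real.exp (t₀ * k) with hE
  have hE0 : 0 < E := Real.exp_pos _
  set a := E * (Q * x₀) with ha
  have ha0 : 0 < a := by positivity
  obtain ⟨φ₀, hφ₀⟩ := hwin a hk
  obtain ⟨u, hu⟩ := hsteer (φ₀ - (β - 1 / (q ^ 2 * δ 0)))
  refine ⟨glueSeq m z u, ?_, fun y hy => ?_⟩
  · rw [PiNat.mem_cylinder_iff]
    intro i hi
    simp [glueSeq, hi]
  have hyz : y ∈ PiNat.cylinder z m := by
    rw [PiNat.mem_cylinder_iff] at hy ⊢
    intro i hi
    rw [hy i (by omega)]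
    simp [glueSeq, hi]
  have hyu : (fun k => y (k + m)) ∈ PiNat.cylinder u r := by
    rw [PiNat.mem_cylinder_iff] at hy ⊢
    intro i hi
    rw [hy (i + m) (by omega)]
    simp [glueSeq]
  obtain ⟨w, hw⟩ := hu _ hyu
  have hyU := hU fun k => y (k + m)
  rw [glueSeq_eq_of_mem_cylinder hyz] at hyU
  set v := digitExpand N fun k => y (k + m) with hv
  have hv01 : v ∈ Set.Icc (0 : ℝ) 1 := ⟨digitExpand_nonneg _, digitExpand_le_one hN hD _⟩
  have hδv := hδx v hv01
  have hδ0 := hδx 0 ⟨le_rfl, zero_le_one⟩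
  have hyδ : digitExpand N y - p / q = δ v := by rw [hyU]
  have hpos : ∀ {x : ℝ}, |x / x₀ - 1| ≤ 2 * τ → x₀ / 2 ≤ x := by
    intro x hx
    have h1 := (abs_le.1 hx).1
    have : 1 / 2 ≤ x / x₀ := by linarith
    rw [le_div_iff₀ hx₀0] at this
    linarith
  have hδv0 : 0 < δ v := by linarith [hpos hδv]
  have hδ00 : 0 < δ 0 := by linarith [hpos hδ0]
  obtain ⟨Γ, hΓ, h00, h01', h10⟩ := hβ (t₀ * k) (digitExpand N y) (-w) (by
    intro h
    have : digitExpand N y - p / q = 0 := by rw [h]; push_cast; ring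
    linarith)
  push_cast at h00 h01' h10
  rw [hyδ] at h00 h01'
  set a' := E * (q * δ v) with ha'
  have ha'a : a' = a * (q / Q * (δ v / x₀)) := by rw [ha', ha]; field_simp
  have ha'0 : 0 < a' := by positivity
  obtain ⟨γ, hγ, hγV⟩ : ∃ γ ∈ SL2Zsub, g2 (t₀ * k) * upperMat (digitExpand N y) * Γ * γ ∈ V := by
    refine hφ₀ a' (Real.exp (-(t₀ * k)) * q / a') (β - 1 / (q ^ 2 * δ v) + -w) ?_ ?_ ?_
      _ h00 h01' (by rw [h10]; field_simp)
    · have h1 := abs_mul_sub_one_le hτ0.le hτ1 hκ hδv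
      have h2 : a' - a = (q / Q * (δ v / x₀) - 1) * a := by rw [ha'a]; ring
      rw [h2, abs_mul, abs_of_pos ha0]
      gcongr
      linarith
    · have h1 : Real.exp (-(t₀ * k)) = 1 / E := by rw [Real.exp_neg, one_div]
      have h2 : Real.exp (-(t₀ * k)) * q / a' = x₀ / δ v * (1 / (R₀ * a ^ 2)) := by
        rw [h1, ha', ha, hx₀]
        field_simp
      have h3 : x₀ / δ v ≤ 2 := by
        rw [div_le_iff₀ hδv0]; linarith [hpos hδv]
      have h4 : 0 < x₀ / δ v * (1 / (R₀ * a ^ 2)) := by positivity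
      rw [h2, abs_of_pos h4]
      calc x₀ / δ v * (1 / (R₀ * a ^ 2)) ≤ 2 * (1 / (R₀ * A ^ 2)) := by
            have := hk.1
            gcongr
        _ ≤ η := by
            rw [mul_one_div, div_le_iff₀ (by positivity)]
            linarith
    · have h1 := abs_inv_mul_sub_one_le hτ0.le hτ1 hκ hδ0 hδv
      have e1 : 1 / (q ^ 2 * δ 0) - 1 / (q ^ 2 * δ v) =
          v * (l * (1 / ((q / Q) ^ 2 * (δ 0 / x₀) * (δ v / x₀)))) := by
        have e2 : δ v - δ 0 = v / P := by simp only [hδ]; ring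
        have e3 : 1 / (q ^ 2 * δ 0) - 1 / (q ^ 2 * δ v) = v / P / (q ^ 2 * δ 0 * δ v) := by
          rw [← e2]; field_simp
        have e4 : l = R₀ ^ 2 * Q ^ 2 / P := by rw [hQ]; field_simp
        rw [e3, e4, hx₀]
        field_simp
      set κ := 1 / ((q / Q : ℝ) ^ 2 * (δ 0 / x₀) * (δ v / x₀)) with hκdef
      have e5 : β - 1 / (q ^ 2 * δ v) + -w - φ₀ =
          (l * v - (φ₀ - (β - 1 / (q ^ 2 * δ 0))) - w) + l * v * (κ - 1) := by
        linear_combination e1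
      have h6 : |l * v * (κ - 1)| ≤ η / 2 := by
        rw [abs_mul, abs_of_nonneg (mul_nonneg hl.le hv01.1)]
        calc l * v * |κ - 1| ≤ l * 1 * (20 * τ) := by
              have := hv01.2
              have := hv01.1
              gcongr
          _ = 20 * τ * l := by ring
          _ ≤ _ := hτ2
      rw [e5]
      refine (abs_add_le _ _).trans ?_
      linarith
  refine ⟨k, Γ * γ, mul_mem hΓ hγ, ?_⟩
  rw [g2_pow, ← mul_assoc]
  exact hγV

lemma continuous_upperMat_orbit {α : Type*} [TopologicalSpace α] {f : α → ℝ} (hf : Continuous f)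
    (g γ : SL2R) : Continuous fun x => g * upperMat (f x) * γ := by
  refine continuous_induced_rng.2 (continuous_matrix fun i j => ?_)
  simp only [Function.comp_apply, Matrix.SpecialLinearGroup.coe_mul, coe_upperMat,
    Matrix.mul_apply, Fin.sum_univ_two, Matrix.of_apply, Matrix.cons_val', Matrix.cons_val_zero,
    Matrix.cons_val_one, Matrix.cons_val_fin_one]
  fun_prop

lemma ae_exists_orbit_mem {V : Set SL2R} (hV : IsOpen V) (hne : V.Nonempty) {t₀ : ℝ}
    (ht₀ : 0 < t₀) {N : ℕ} {D : Finset ℕ} [Nonempty D] (hN : 2 ≤ N) (hD : ∀ d ∈ D, d < N)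
    (hcard : N ≤ 2 * D.card) (hcard' : 1 < D.card) (hB : symbolBound N D ^ 24 ≤ N) :
    ∀ᵐ ω ∂digitMeasure D, ∃ k : ℕ, ∃ γ ∈ SL2Zsub,
      g2 t₀ ^ k * upperMat (digitExpand N ω) * γ ∈ V := by
  obtain ⟨d₀, hd₀, d₁, hd₁, hne'⟩ := Finset.one_lt_card.1 hcard'
  obtain ⟨d₀, d₁, h01⟩ : ∃ d₀ d₁ : D, (d₀ : ℕ) < d₁ := by
    rcases hne'.lt_or_gt with h | h
    · exact ⟨⟨d₀, hd₀⟩, ⟨d₁, hd₁⟩, h⟩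
    · exact ⟨⟨d₁, hd₁⟩, ⟨d₀, hd₀⟩, h⟩
  obtain ⟨τ, hτ, hτ1, R₀, hR₀, l, hl, r, Q₁, -, hsteer⟩ :=
    exists_steered_cylinder hV hne ht₀ hN hD h01
  have hN1 : (1 : ℝ) < N := by exact_mod_cast hN
  have hR0 : 0 < R₀ := by linarith
  have hcont := continuous_digitExpand hN hD
  set G : Set (ℕ → D) := {ω | ∃ k : ℕ, ∃ γ ∈ SL2Zsub,
    g2 t₀ ^ k * upperMat (digitExpand N ω) * γ ∈ V} with hG
  have hGo : IsOpen G := by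
    have : G = ⋃ k : ℕ, ⋃ γ ∈ SL2Zsub,
        (fun ω => g2 t₀ ^ k * upperMat (digitExpand N ω) * γ) ⁻¹' V := by
      ext ω; simp [hG]
    rw [this]
    exact isOpen_iUnion fun k => isOpen_iUnion fun γ => isOpen_iUnion fun _ =>
      hV.preimage (continuous_upperMat_orbit hcont _ _)
  refine measure_compl_eq_zero_of_steering hGo r
    (c := ENNReal.ofReal (τ ^ 2 / (40 * R₀))) (by simp; positivity) fun ω m => ?_
  have hgm : Measurable fun y => digitExpand N (glueSeq m ω y) :=
    hcont.measurable.comp (measurable_glueSeq m ω)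
  have hprob : IsProbabilityMeasure ((digitMeasure D).map fun y => digitExpand N (glueSeq m ω y)) :=
    Measure.isProbabilityMeasure_map hgm.aemeasurable
  have hev := eventually_measure_reducedApprox hτ hτ1 hR₀ _
    (summable_fourierMass_glueSeq hN hD hcard hB m ω)
  set Q : ℕ → ℝ := fun m' => Real.sqrt (l * (N : ℝ) ^ m') / R₀ with hQ
  have hQlim : Tendsto Q atTop atTop :=
    (Real.tendsto_sqrt_atTop.comp
      ((tendsto_pow_atTop_atTop_of_one_lt hN1).const_mul_atTop hl)).atTop_div_const hR0
  obtain ⟨m', hm', hQ1, hμ⟩ := ((eventually_ge_atTop m).and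
    ((hQlim.eventually_ge_atTop Q₁).and (hQlim.eventually hev))).exists
  have hQ2 : R₀ ^ 2 * Q m' ^ 2 = l * (N : ℝ) ^ m' := by
    simp only [hQ]
    rw [div_pow, Real.sq_sqrt (by positivity)]
    field_simp
  set T : Set ℝ := {s | ReducedApprox ⌊Q m'⌋₊ ⌊(1 + τ) * Q m'⌋₊ (1 / (R₀ * Q m' ^ 2))
    (τ / (R₀ * Q m' ^ 2)) s} with hT
  have hTo : IsOpen T := isOpen_setOf_reducedApprox _ _ _ _
  refine ⟨m', hm', digitExpand N ⁻¹' T, (hTo.preimage hcont).measurableSet, ?_,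
    fun z hz => hsteer m' (Q m') hQ1 hQ2 z hz⟩
  rw [Measure.real, Measure.map_apply hgm hTo.measurableSet] at hμ
  exact ENNReal.ofReal_le_of_le_toReal hμ

lemma ae_dense_orbit {t₀ : ℝ} (ht₀ : 0 < t₀) {N : ℕ} {D : Finset ℕ} [Nonempty D] (hN : 2 ≤ N)
    (hD : ∀ d ∈ D, d < N) (hcard : N ≤ 2 * D.card) (hcard' : 1 < D.card)
    (hB : symbolBound N D ^ 24 ≤ N) :
    ∀ᵐ ω ∂digitMeasure D,
      closure (Set.range fun k : ℕ => g2 t₀ ^ k • h2 (digitExpand N ω)) = Set.univ := by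
  have : SecondCountableTopology (Matrix (Fin 2) (Fin 2) ℝ) :=
    inferInstanceAs (SecondCountableTopology (Fin 2 → Fin 2 → ℝ))
  have : SecondCountableTopology SL2R :=
    TopologicalSpace.secondCountableTopology_induced SL2R (Matrix (Fin 2) (Fin 2) ℝ) _
  have hall : ∀ᵐ ω ∂digitMeasure D, ∀ V ∈ TopologicalSpace.countableBasis SL2R,
      ∃ k : ℕ, ∃ γ ∈ SL2Zsub, g2 t₀ ^ k * upperMat (digitExpand N ω) * γ ∈ V := by
    rw [ae_ball_iff (TopologicalSpace.countable_countableBasis SL2R)]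
    intro V hV
    exact ae_exists_orbit_mem (TopologicalSpace.isOpen_of_mem_countableBasis hV)
      (TopologicalSpace.nonempty_of_mem_countableBasis hV) ht₀ hN hD hcard hcard' hB
  filter_upwards [hall] with ω hω
  refine Set.eq_univ_of_forall fun x => mem_closure_iff.2 fun O hO hx => ?_
  obtain ⟨M, rfl⟩ := QuotientGroup.mk_surjective x
  have hO' : IsOpen ((QuotientGroup.mk : SL2R → X2) ⁻¹' O) := hO.preimage continuous_quot_mk
  obtain ⟨V, hV, -, hVO⟩ :=
    (TopologicalSpace.isBasis_countableBasis SL2R).exists_subset_of_mem_open hx hO'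
  obtain ⟨k, γ, hγ, h⟩ := hω V hV
  refine ⟨g2 t₀ ^ k • h2 (digitExpand N ω), ?_, ⟨k, rfl⟩⟩
  have h' := hVO h
  rw [Set.mem_preimage, QuotientGroup.mk_mul_of_mem _ hγ] at h'
  exact h'

/-- The integer whose base `N` digits are the first `m` terms of `ω`. -/
def digitPrefix (N : ℕ) {D : Finset ℕ} (ω : ℕ → D) : ℕ → ℕ
  | 0 => 0
  | m + 1 => N * digitPrefix N ω m + ω m

section Prefix

variable {N : ℕ} {D : Finset ℕ}

lemma mem_cylinder_of_digitPrefix_eq (hD : ∀ d ∈ D, d < N) {ω z : ℕ → D} {m : ℕ}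
    (h : digitPrefix N z m = digitPrefix N ω m) : z ∈ PiNat.cylinder ω m := by
  induction m with
  | zero => simp
  | succ m ih =>
    have hz := hD _ (z m).2
    have hω := hD _ (ω m).2
    have hN : 0 < N := by omega
    simp only [digitPrefix] at h
    have h1 : digitPrefix N z m = digitPrefix N ω m := by
      have := congrArg (· / N) h
      simpa [Nat.mul_add_div hN, Nat.div_eq_of_lt hz, Nat.div_eq_of_lt hω] using this
    have h2 : (z m : ℕ) = ω m := by rw [h1] at h; omega
    have hc := PiNat.mem_cylinder_iff.1 (ih h1)
    refine PiNat.mem_cylinder_iff.2 fun i hi => ?_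
    rcases Nat.lt_succ_iff_lt_or_eq.1 hi with hi | rfl
    · exact hc i hi
    · exact Subtype.ext h2

lemma digitExpand_eq_head_add (hN : 2 ≤ N) (hD : ∀ d ∈ D, d < N) (ω : ℕ → D) :
    digitExpand N ω = ((ω 0 : ℕ) + digitExpand N fun k => ω (k + 1)) / N := by
  rw [← digitExpand_consSeq hN hD]
  congr 1
  ext1 k
  cases k <;> rfl

lemma pow_mul_digitExpand (hN : 2 ≤ N) (hD : ∀ d ∈ D, d < N) (ω : ℕ → D) (m : ℕ) :
    (N : ℝ) ^ m * digitExpand N ω = digitPrefix N ω m + digitExpand N fun k => ω (k + m) := by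
  induction m with
  | zero => simp [digitPrefix]
  | succ m ih =>
    have hN0 : (N : ℝ) ≠ 0 := by positivity
    rw [pow_succ', mul_assoc, ih, digitExpand_eq_head_add hN hD fun k => ω (k + m)]
    simp only [digitPrefix, zero_add, Nat.cast_add, Nat.cast_mul, add_assoc, add_comm 1 m]
    field_simp

lemma digitMeasure_setOf_digitPrefix_le [Nonempty D] (hD : ∀ d ∈ D, d < N) (m : ℕ) (j : ℤ) :
    digitMeasure D {ω | (digitPrefix N ω m : ℤ) = j} ≤ (D.card : ℝ≥0∞)⁻¹ ^ m := by
  rcases Set.eq_empty_or_nonempty {ω : ℕ → D | (digitPrefix N ω m : ℤ) = j} with h | ⟨ω, hω⟩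
  · simp [h]
  · rw [← digitMeasure_cylinder D m ω]
    refine measure_mono fun z hz => mem_cylinder_of_digitPrefix_eq hD ?_
    rw [Set.mem_ofPred_eq] at hz hω
    exact_mod_cast hz.trans hω.symm

lemma digitMeasure_preimage_le [Nonempty D] (hN : 2 ≤ N) (hD : ∀ d ∈ D, d < N) {s : Set ℝ} {m : ℕ}
    (hs : Metric.ediam s ≤ ENNReal.ofReal (1 / (N : ℝ) ^ m)) :
    digitMeasure D (digitExpand N ⁻¹' s) ≤ 4 * (D.card : ℝ≥0∞)⁻¹ ^ m := by
  rcases Set.eq_empty_or_nonempty s with rfl | ⟨x, hx⟩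
  · simp
  have hNm : (0 : ℝ) < (N : ℝ) ^ m := by positivity
  set I := Finset.Icc (⌈(N : ℝ) ^ m * x⌉ - 2) (⌊(N : ℝ) ^ m * x⌋ + 1) with hI
  have hsub : digitExpand N ⁻¹' s ⊆ ⋃ j ∈ I, {ω : ℕ → D | (digitPrefix N ω m : ℤ) = j} := by
    intro ω hω
    have hd : |digitExpand N ω - x| ≤ 1 / (N : ℝ) ^ m := by
      have := (Metric.edist_le_ediam_of_mem (Set.mem_preimage.1 hω) hx).trans hs
      rwa [edist_dist, ENNReal.ofReal_le_ofReal_iff (by positivity), Real.dist_eq] at this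
    rw [le_div_iff₀ hNm, ← abs_of_pos hNm, ← abs_mul, abs_le] at hd
    have h1 := pow_mul_digitExpand hN hD ω m
    have h2 := digitExpand_nonneg (N := N) fun k => ω (k + m)
    have h3 := digitExpand_le_one hN hD fun k => ω (k + m)
    simp only [Set.mem_iUnion, Set.mem_ofPred_eq, exists_prop, exists_eq_right', hI,
      Finset.mem_Icc]
    constructor
    · have : ⌈(N : ℝ) ^ m * x⌉ ≤ (digitPrefix N ω m : ℤ) + 2 := by
        rw [Int.ceil_le]; push_cast; linarith
      omega
    · have : (digitPrefix N ω m : ℤ) - 1 ≤ ⌊(N : ℝ) ^ m * x⌋ := by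
        rw [Int.le_floor]; push_cast; linarith
      omega
  have hcard : I.card ≤ 4 := by
    rw [hI, Int.card_Icc]
    have := Int.floor_le_ceil ((N : ℝ) ^ m * x)
    omega
  calc digitMeasure D (digitExpand N ⁻¹' s)
      ≤ ∑ j ∈ I, digitMeasure D {ω : ℕ → D | (digitPrefix N ω m : ℤ) = j} :=
        (measure_mono hsub).trans (measure_biUnion_finset_le _ _)
    _ ≤ ∑ _j ∈ I, (D.card : ℝ≥0∞)⁻¹ ^ m :=
        Finset.sum_le_sum fun j _ => digitMeasure_setOf_digitPrefix_le hD m j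
    _ ≤ 4 * (D.card : ℝ≥0∞)⁻¹ ^ m := by
        rw [Finset.sum_const, nsmul_eq_mul]
        gcongr
        exact_mod_cast hcard

lemma map_digitExpand_absolutelyContinuous [Nonempty D] (hN : 2 ≤ N) (hD : ∀ d ∈ D, d < N)
    (hcard : 1 < D.card) {δ : NNReal} (hδ : (N : ℝ) ^ (δ : ℝ) ≤ D.card) :
    (digitMeasure D).map (digitExpand N) ≪ μH[δ] := by
  have hmeas : Measurable (digitExpand N : (ℕ → D) → ℝ) := (continuous_digitExpand hN hD).measurable
  have hN1 : (1 : ℝ) < N := by exact_mod_cast hN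
  have hc0 : (0 : ℝ) < D.card := by positivity
  set c : ℝ≥0∞ := (4 * D.card : ℝ≥0∞)⁻¹ with hc
  have hcne : c ≠ 0 := by
    simp only [hc, ne_eq, ENNReal.inv_eq_zero]
    exact ENNReal.mul_ne_top (by simp) (by simp)
  have hle : c • (digitMeasure D).map (digitExpand N) ≤ μH[δ] := by
    refine Measure.le_hausdorffMeasure _ _ 1 one_pos fun s hs => ?_
    rw [Measure.smul_apply, smul_eq_mul, ← Metric.ediam_closure]
    rw [← Metric.ediam_closure] at hs
    refine (mul_le_mul_right (measure_mono subset_closure) c).trans ?_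
    rw [Measure.map_apply hmeas isClosed_closure.measurableSet]
    generalize closure s = K at hs
    have hbound : ∀ m : ℕ, Metric.ediam K ≤ ENNReal.ofReal (1 / (N : ℝ) ^ m) →
        c * digitMeasure D (digitExpand N ⁻¹' K) ≤ (D.card : ℝ≥0∞)⁻¹ ^ (m + 1) := by
      intro m hm
      calc c * digitMeasure D (digitExpand N ⁻¹' K)
          ≤ c * (4 * (D.card : ℝ≥0∞)⁻¹ ^ m) := by
            gcongr; exact digitMeasure_preimage_le hN hD hm
        _ = (4⁻¹ * 4) * ((D.card : ℝ≥0∞)⁻¹ ^ m * (D.card : ℝ≥0∞)⁻¹) := by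
            rw [hc, ENNReal.mul_inv (by simp) (by simp)]; ring
        _ = (D.card : ℝ≥0∞)⁻¹ ^ (m + 1) := by
            rw [ENNReal.inv_mul_cancel (by simp) (by simp), one_mul, pow_succ]
    rcases eq_or_ne (Metric.ediam K) 0 with h0 | h0
    · refine le_of_eq_of_le (le_antisymm ?_ zero_le) zero_le
      refine ge_of_tendsto' (x := atTop) ((tendsto_add_atTop_iff_nat 1).2
        (ENNReal.tendsto_pow_atTop_nhds_zero_of_lt_one (r := (D.card : ℝ≥0∞)⁻¹) ?_))
        fun m => hbound m (h0 ▸ zero_le)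
      rw [ENNReal.inv_lt_one]
      exact_mod_cast hcard
    · have htop : Metric.ediam K ≠ ⊤ := ne_top_of_le_ne_top (by simp) hs
      set r := (Metric.ediam K).toReal with hr
      have hr0 : 0 < r := ENNReal.toReal_pos h0 htop
      have hr1 : r ≤ 1 := ENNReal.toReal_le_of_le_ofReal zero_le_one (by simpa using hs)
      have hrK : Metric.ediam K = ENNReal.ofReal r := (ENNReal.ofReal_toReal htop).symm
      obtain ⟨m, hm1, hm2⟩ := exists_nat_pow_near_of_lt_one hr0 hr1
        (show (0 : ℝ) < 1 / N by positivity) (by rw [div_lt_one (by linarith)]; exact hN1)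
      rw [_root_.one_div_pow] at hm1 hm2
      refine (hbound m (hrK ▸ ENNReal.ofReal_le_ofReal hm2)).trans ?_
      rw [hrK, ENNReal.ofReal_rpow_of_pos hr0, ← ENNReal.ofReal_natCast,
        ← ENNReal.ofReal_inv_of_pos hc0, ← ENNReal.ofReal_pow (inv_nonneg.2 hc0.le)]
      refine ENNReal.ofReal_le_ofReal ?_
      calc ((D.card : ℝ)⁻¹) ^ (m + 1) ≤ (((N : ℝ) ^ (δ : ℝ))⁻¹) ^ (m + 1) :=
            pow_le_pow_left₀ (inv_nonneg.2 hc0.le) (inv_anti₀ (by positivity) hδ) _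
        _ = (1 / (N : ℝ) ^ (m + 1)) ^ (δ : ℝ) := by
            rw [one_div, Real.inv_rpow (by positivity), inv_pow, ← Real.rpow_natCast (_ ^ _),
              ← Real.rpow_mul (by positivity), ← Real.rpow_natCast, ← Real.rpow_mul (by positivity),
              mul_comm]
        _ ≤ r ^ (δ : ℝ) := by gcongr
  intro s hs
  have h := hle s
  rw [hs, Measure.smul_apply, smul_eq_mul, nonpos_iff_eq_zero, mul_eq_zero] at h
  exact h.resolve_left hcne

/-- The mass distribution principle for random digit expansions. -/
lemma le_dimH_of_ae_digitExpand_mem [Nonempty D] (hN : 2 ≤ N) (hD : ∀ d ∈ D, d < N)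
    (hcard : 1 < D.card) {δ : NNReal} (hδ : (N : ℝ) ^ (δ : ℝ) ≤ D.card) {s : Set ℝ}
    (hs : ∀ᵐ ω ∂digitMeasure D, digitExpand N ω ∈ s) : δ ≤ dimH s := by
  by_contra! h
  have h0 := measure_zero_of_dimH_lt (map_digitExpand_absolutelyContinuous hN hD hcard hδ) h
  have hmeas : Measurable (digitExpand N : (ℕ → D) → ℝ) := (continuous_digitExpand hN hD).measurable
  have h1 : digitMeasure D (digitExpand N ⁻¹' s) = 0 :=
    le_antisymm ((Measure.le_map_apply hmeas.aemeasurable s).trans h0.le) zero_le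
  have h2 : digitMeasure D (digitExpand N ⁻¹' s) = 1 := by
    rw [← measure_univ (μ := digitMeasure D)]
    exact measure_congr (eventuallyEq_univ.2 hs)
  exact zero_ne_one (h1.symm.trans h2)

end Prefix

/-- The `d`-th closed arc of the partition of the circle into `N` arcs of equal length. -/
def arc (N d : ℕ) : Set Circ := (fun x : ℝ => (x : Circ)) '' Set.Icc ((d : ℝ) / N) ((d + 1) / N)

lemma isClosed_arc (N d : ℕ) : IsClosed (arc N d) :=
  (isCompact_Icc.image (AddCircle.continuous_mk' 1)).isClosed

open Classical in
lemma card_filter_mem_arc_le {N : ℕ} (hN : 0 < N) (p : Circ) :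
    ((Finset.range N).filter fun d => p ∈ arc N d).card ≤ 3 := by
  obtain ⟨x, ⟨hx0, hx1⟩, rfl⟩ : ∃ x ∈ Set.Ico (0 : ℝ) 1, (x : Circ) = p := by
    have h := (AddCircle.equivIco 1 0 p).2
    exact ⟨AddCircle.equivIco 1 0 p, by simpa using h, (AddCircle.equivIco 1 0).symm_apply_apply p⟩
  have hN' : (0 : ℝ) < N := by exact_mod_cast hN
  refine (Finset.card_le_card (t := {⌊N * x⌋₊, ⌊N * x⌋₊ - 1, N - 1}) fun d hd => ?_).trans
    Finset.card_le_three
  simp only [Finset.mem_filter, Finset.mem_range, arc, Set.mem_image] at hd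
  obtain ⟨hd, y, ⟨hy1, hy2⟩, hyx⟩ := hd
  rw [div_le_iff₀ hN'] at hy1
  rw [le_div_iff₀ hN'] at hy2
  have hdN : (d : ℝ) + 1 ≤ N := by exact_mod_cast hd
  obtain ⟨k, hk⟩ : ∃ k : ℤ, y = x + k := by
    rw [← sub_eq_zero, ← AddCircle.coe_sub, AddCircle.coe_eq_zero_iff] at hyx
    obtain ⟨k, hk⟩ := hyx
    exact ⟨k, by simp at hk; linarith⟩
  have hy0 : 0 ≤ y := by
    by_contra! h
    nlinarith [(Nat.cast_nonneg d : (0 : ℝ) ≤ d)]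
  have hyle : y ≤ 1 := by
    by_contra! h
    nlinarith
  have hk0 : 0 ≤ k := by
    by_contra! h
    have : (k : ℝ) ≤ -1 := by exact_mod_cast (by omega : k ≤ -1)
    linarith
  simp only [Finset.mem_insert, Finset.mem_singleton]
  rcases hk0.eq_or_lt with rfl | hk0
  · simp only [Int.cast_zero, add_zero] at hk
    subst hk
    have h1 : d ≤ ⌊N * y⌋₊ := Nat.le_floor (by linarith)
    have h2 : ⌊N * y⌋₊ ≤ d + 1 := by
      have : (⌊N * y⌋₊ : ℝ) ≤ N * y := Nat.floor_le (by positivity)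
      exact_mod_cast (by linarith : (⌊N * y⌋₊ : ℝ) ≤ (d : ℝ) + 1)
    omega
  · have : (1 : ℝ) ≤ k := by exact_mod_cast hk0
    have hy : y = 1 := by linarith
    rw [hy, one_mul] at hy2
    have : N ≤ d + 1 := by exact_mod_cast hy2
    omega

open Classical in
/-- The digits in base `N` whose arcs contain no point of the finite set `B`. -/
def digitsAvoiding (N : ℕ) (B : Finset Circ) : Finset ℕ :=
  (Finset.range N).filter fun d => ∀ p ∈ B, p ∉ arc N d

lemma lt_of_mem_digitsAvoiding {N d : ℕ} {B : Finset Circ} (h : d ∈ digitsAvoiding N B) :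
    d < N := by
  classical
  exact Finset.mem_range.1 (Finset.mem_filter.1 h).1

lemma card_range_sdiff_digitsAvoiding_le {N : ℕ} (hN : 0 < N) (B : Finset Circ) :
    (Finset.range N \ digitsAvoiding N B).card ≤ 3 * B.card := by
  classical
  have hsub : Finset.range N \ digitsAvoiding N B ⊆
      B.biUnion fun p => (Finset.range N).filter fun d => p ∈ arc N d := by
    intro d hd
    simp only [digitsAvoiding, Finset.mem_sdiff, Finset.mem_filter, Finset.mem_range,
      Finset.mem_biUnion] at hd ⊢
    grind
  refine (Finset.card_le_card hsub).trans ?_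
  rw [mul_comm]
  refine Finset.card_biUnion_le_card_mul _ _ _ fun p _ => ?_
  convert! card_filter_mem_arc_le hN p

lemma card_le_card_digitsAvoiding_add {N : ℕ} (hN : 0 < N) (B : Finset Circ) :
    N ≤ (digitsAvoiding N B).card + 3 * B.card := by
  have h1 := card_range_sdiff_digitsAvoiding_le hN B
  have h2 : digitsAvoiding N B ⊆ Finset.range N := fun d hd =>
    Finset.mem_range.2 (lt_of_mem_digitsAvoiding hd)
  rw [Finset.card_sdiff_of_subset h2, Finset.card_range] at h1
  omega

/-- The points `b ^ r • σ` with `r ≤ h` and `σ ∈ S`. -/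
def forwardImages [DecidableEq Circ] (b h : ℕ) (S : Finset Circ) : Finset Circ :=
  (Finset.range (h + 1) ×ˢ S).image fun x => b ^ x.1 • x.2

lemma card_forwardImages_le [DecidableEq Circ] (b h : ℕ) (S : Finset Circ) :
    (forwardImages b h S).card ≤ (h + 1) * S.card := by
  refine Finset.card_image_le.trans ?_
  simp

lemma nsmul_mem_forwardImages [DecidableEq Circ] {b h r : ℕ} (hr : r ≤ h) {S : Finset Circ}
    {σ : Circ} (hσ : σ ∈ S) : b ^ r • σ ∈ forwardImages b h S :=
  Finset.mem_image.2 ⟨(r, σ), by simp [hσ, Nat.lt_succ_of_le hr], rfl⟩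

lemma digitExpand_mem_arc {N : ℕ} {D : Finset ℕ} (hN : 2 ≤ N) (hD : ∀ d ∈ D, d < N) (ω : ℕ → D) :
    (digitExpand N ω : Circ) ∈ arc N (ω 0) := by
  refine ⟨digitExpand N ω, ?_, rfl⟩
  rw [digitExpand_eq_head_add hN hD]
  have h1 := digitExpand_nonneg (N := N) fun k => ω (k + 1)
  have h2 := digitExpand_le_one hN hD fun k => ω (k + 1)
  constructor
  · gcongr; linarith
  · gcongr

lemma pow_nsmul_digitExpand {N : ℕ} {D : Finset ℕ} (hN : 2 ≤ N) (hD : ∀ d ∈ D, d < N) (ω : ℕ → D)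
    (m : ℕ) : N ^ m • (digitExpand N ω : Circ) = (digitExpand N fun k => ω (k + m) : ℝ) := by
  rw [← AddCircle.coe_nsmul, nsmul_eq_mul, Nat.cast_pow, pow_mul_digitExpand hN hD]
  have h : (digitPrefix N ω m : ℝ) = digitPrefix N ω m • (1 : ℝ) := by simp
  rw [AddCircle.coe_add, h, AddCircle.coe_nsmul, AddCircle.coe_period, nsmul_zero, zero_add]

lemma closure_orbit_inter_eq_empty {b h N : ℕ} (hb : 2 ≤ b) (hh : 0 < h) (hNb : N = b ^ h)
    {S : Set Circ} {B : Finset Circ} (hB : ∀ r ≤ h, ∀ σ ∈ S, b ^ r • σ ∈ B)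
    (ω : ℕ → digitsAvoiding N B) :
    closure (Set.range fun k : ℕ => b ^ k • (digitExpand N ω : Circ)) ∩ S = ∅ := by
  classical
  have hN : 2 ≤ N := hNb ▸ hb.trans (Nat.le_self_pow hh.ne' b)
  have hD : ∀ d ∈ digitsAvoiding N B, d < N := fun d => lt_of_mem_digitsAvoiding
  set F : Set Circ := ⋃ r ∈ Finset.range (h + 1), ⋃ d ∈ digitsAvoiding N B,
    (fun y : Circ => b ^ r • y) ⁻¹' arc N d with hF
  have hFc : IsClosed F :=
    isClosed_biUnion_finset fun r _ => isClosed_biUnion_finset fun d _ =>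
      (isClosed_arc N d).preimage (continuous_const_smul _)
  have hsub : closure (Set.range fun k : ℕ => b ^ k • (digitExpand N ω : Circ)) ⊆ F := by
    refine closure_minimal ?_ hFc
    rintro _ ⟨k, rfl⟩
    set j := k / h + 1
    have h1 : k ≤ h * j := by
      have := Nat.lt_mul_div_succ k hh
      exact this.le
    have h2 : h * j ≤ k + h := by
      have := Nat.mul_div_le k h
      simp only [j, mul_add]; omega
    simp only [hF, Set.mem_iUnion, Finset.mem_range, Set.mem_preimage, exists_prop]
    refine ⟨h * j - k, by omega, ω j, (ω j).2, ?_⟩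
    rw [smul_smul, ← pow_add, Nat.sub_add_cancel h1, pow_mul, ← hNb, pow_nsmul_digitExpand hN hD]
    simpa using digitExpand_mem_arc hN hD fun i => ω (i + j)
  refine Set.eq_empty_of_forall_notMem fun σ hσ => ?_
  have hσF := hsub hσ.1
  simp only [hF, Set.mem_iUnion, Finset.mem_range, Set.mem_preimage, exists_prop] at hσF
  obtain ⟨r, hr, d, hd, hmem⟩ := hσF
  refine (Finset.mem_filter.1 hd).2 (b ^ r • σ) (hB r (by omega) σ hσ.2) hmem

lemma eventually_digitsAvoiding [DecidableEq Circ] {b : ℕ} (hb : 2 ≤ b) (S : Finset Circ)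
    {δ : NNReal} (hδ : δ < 1) :
    ∀ᶠ h : ℕ in atTop, b ^ h ≤ 2 * (digitsAvoiding (b ^ h) (forwardImages b h S)).card ∧
      1 < (digitsAvoiding (b ^ h) (forwardImages b h S)).card ∧
      symbolBound (b ^ h) (digitsAvoiding (b ^ h) (forwardImages b h S)) ^ 24 ≤ (b ^ h : ℕ) ∧
      ((b ^ h : ℕ) : ℝ) ^ (δ : ℝ) ≤ (digitsAvoiding (b ^ h) (forwardImages b h S)).card := by
  have hb1 : (1 : ℝ) < b := by exact_mod_cast hb
  have hδ' : (δ : ℝ) < 1 := by exact_mod_cast hδ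
  set C : ℝ := 2 * (2 * (1 + Real.log b) + 6 * S.card) with hC
  have hlog : 0 ≤ Real.log b := Real.log_nonneg hb1.le
  have hC0 : 0 ≤ C := by positivity
  have hpow : Tendsto (fun h : ℕ => (b : ℝ) ^ h) atTop atTop :=
    tendsto_pow_atTop_atTop_of_one_lt hb1
  have e1 : ∀ᶠ h : ℕ in atTop, (C * h) ^ 24 ≤ (b : ℝ) ^ h := by
    have := (tendsto_pow_const_div_const_pow_of_one_lt 24 hb1).const_mul (C ^ 24)
    rw [mul_zero] at this
    filter_upwards [this.eventually_le_const one_pos] with h hh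
    rw [mul_div, div_le_one (by positivity), ← mul_pow] at hh
    exact hh
  have e2 : ∀ᶠ h : ℕ in atTop, 12 * (S.card : ℝ) * h ≤ (b : ℝ) ^ h := by
    have := (tendsto_pow_const_div_const_pow_of_one_lt 1 hb1).const_mul (12 * (S.card : ℝ))
    rw [mul_zero] at this
    filter_upwards [this.eventually_le_const one_pos] with h hh
    rwa [mul_div, div_le_one (by positivity), pow_one] at hh
  have e3 : ∀ᶠ h : ℕ in atTop, 2 ≤ ((b : ℝ) ^ h) ^ (1 - (δ : ℝ)) :=
    ((tendsto_rpow_atTop (by linarith)).comp hpow).eventually_ge_atTop 2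
  filter_upwards [e1, e2, e3, hpow.eventually_ge_atTop 4, eventually_ge_atTop 1]
    with h h1 h2 h3 h4 hh
  set N := b ^ h with hN
  set B := forwardImages b h S
  have hNb : (N : ℝ) = (b : ℝ) ^ h := by rw [hN]; push_cast; rfl
  rw [← hNb] at h1 h2 h3 h4
  have hN0 : 0 < N := by positivity
  have hh' : (1 : ℝ) ≤ h := by exact_mod_cast hh
  have hBc : B.card ≤ 2 * h * S.card :=
    (card_forwardImages_le b h S).trans (Nat.mul_le_mul_right _ (by omega))
  have hBc' : (B.card : ℝ) ≤ 2 * h * S.card := by exact_mod_cast hBc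
  have h5 : (N : ℝ) ≤ (digitsAvoiding N B).card + 3 * B.card := by
    exact_mod_cast card_le_card_digitsAvoiding_add hN0 B
  have h6 : (N : ℝ) ≤ 2 * (digitsAvoiding N B).card := by linarith
  refine ⟨by exact_mod_cast h6, ?_, ?_, ?_⟩
  · have : (2 : ℝ) ≤ (digitsAvoiding N B).card := by linarith
    exact_mod_cast this
  · have h7 : ((Finset.range N \ digitsAvoiding N B).card : ℝ) ≤ 6 * S.card * h := by
      have : ((Finset.range N \ digitsAvoiding N B).card : ℝ) ≤ 3 * B.card := by
        exact_mod_cast card_range_sdiff_digitsAvoiding_le hN0 B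
      linarith
    have hlogN : Real.log N = h * Real.log b := by rw [hNb, Real.log_pow]
    have h0 : 0 ≤ symbolBound N (digitsAvoiding N B) := by
      rw [symbolBound, hlogN]; positivity
    have h1' : symbolBound N (digitsAvoiding N B) ≤ C * h := by
      rw [symbolBound, hlogN, hC]
      linarith
    exact (pow_le_pow_left₀ h0 h1' 24).trans h1
  · have h8 : (N : ℝ) = (N : ℝ) ^ (δ : ℝ) * (N : ℝ) ^ (1 - (δ : ℝ)) := by
      rw [← Real.rpow_add (by positivity)]; simp
    have h9 : 0 ≤ (N : ℝ) ^ (δ : ℝ) := by positivity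
    nlinarith

lemma iterate_zsmul_eq_pow_nsmul (b k : ℕ) (y : Circ) :
    (fun x : Circ => (b : ℤ) • x)^[k] y = b ^ k • y := by
  induction k with
  | zero => simp
  | succ k ih => rw [Function.iterate_succ_apply', ih, natCast_zsmul, smul_smul, pow_succ']

theorem dense_nondense_times_n (n : ℤ) (hn : 2 ≤ n) (S : Set Circ) (hS : S.Finite)
    (t₀ : ℝ) (ht₀ : 0 < t₀) :
    dimH {s : ℝ |
      closure (Set.range fun k : ℕ => (fun x : Circ => n • x)^[k] (s : Circ)) ∩ S = ∅ ∧
      closure (Set.range fun k : ℕ => (g2 t₀) ^ k • h2 s) = Set.univ} = 1 := by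
  classical
  lift n to ℕ using by omega with b
  have hb : 2 ≤ b := by exact_mod_cast hn
  simp only [iterate_zsmul_eq_pow_nsmul]
  refine le_antisymm ((dimH_mono (Set.subset_univ _)).trans_eq Real.dimH_univ) ?_
  refine ENNReal.le_of_forall_nnreal_lt fun δ hδ => ?_
  have hδ1 : δ < 1 := by exact_mod_cast hδ
  obtain ⟨h, ⟨hcard, hcard', hB, hpow⟩, hh⟩ :=
    ((eventually_digitsAvoiding hb hS.toFinset hδ1).and (eventually_gt_atTop 0)).exists
  have : Nonempty (digitsAvoiding (b ^ h) (forwardImages b h hS.toFinset)) :=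
    Finset.nonempty_coe_sort.2 (Finset.card_pos.1 (by omega))
  have hN : 2 ≤ b ^ h := hb.trans (Nat.le_self_pow hh.ne' b)
  have hD : ∀ d ∈ digitsAvoiding (b ^ h) (forwardImages b h hS.toFinset), d < b ^ h :=
    fun d => lt_of_mem_digitsAvoiding
  refine le_dimH_of_ae_digitExpand_mem hN hD hcard' hpow ?_
  filter_upwards [ae_dense_orbit ht₀ hN hD hcard hcard' hB] with ω hω
  exact ⟨closure_orbit_inter_eq_empty hb hh rfl
    (fun r hr σ hσ => nsmul_mem_forwardImages hr (hS.mem_toFinset.2 hσ)) ω, hω⟩
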